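/- arXiv:1905.05728 — 3 statements merged into one kernel-verified Lean document; each statement's English description precedes it below -/
import Mathlib

section
/- There exist T > 0, a velocity V : [0,T]×ℝ² → ℝ², a compact set S ⊂ ℝ², and a map X : [0,T]×ℝ² → ℝ² such that: V is bounded and uniformly continuous on [0,T]×ℝ², V has compact support, V is weakly divergence free; for each t ∈ [0,T] the map V(t,·) is locally Lipschitz on ℝ² \ {(0,0)}; the Hausdorff dimension of S equals 2; X is a trajectory map for V on ℝ²; for every t ∈ [0,T) the Hausdorff dimension of the image X(t, S) := {X(t,a) : a ∈ S} equals 2; and X(T, S) = {(0,0)}. -/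
open MeasureTheory Set

noncomputable section

/-- Dot product on `ℝ × ℝ`. -/
def dot2 (u v : ℝ × ℝ) : ℝ := u.1 * v.1 + u.2 * v.2

/-- Spatial gradient of a scalar function on `ℝ × ℝ`. -/
def grad2 (ψ : ℝ × ℝ → ℝ) (x : ℝ × ℝ) : ℝ × ℝ :=
  (fderiv ℝ ψ x (1, 0), fderiv ℝ ψ x (0, 1))

/-- A velocity field is weakly divergence free at time `t`. -/
def WeakDivFreeAt (u : ℝ → ℝ × ℝ → ℝ × ℝ) (t : ℝ) : Prop :=
  ∀ ψ : ℝ × ℝ → ℝ, ContDiff ℝ (⊤ : ℕ∞) ψ → HasCompactSupport ψ →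
    ∫ x, dot2 (u t x) (grad2 ψ x) = 0

/-- Trajectory map of a velocity field on a set `A`, on the time interval `[0,T]`. -/
def IsTrajOn (T : ℝ) (U : ℝ → ℝ × ℝ → ℝ × ℝ) (A : Set (ℝ × ℝ))
    (X : ℝ → ℝ × ℝ → ℝ × ℝ) : Prop :=
  ∀ a ∈ A, X 0 a = a ∧
    ∀ t ∈ Icc (0 : ℝ) T, HasDerivWithinAt (fun s => X s a) (U t (X t a)) (Icc (0 : ℝ) T) t

open Real

/-- Changing one binary digit changes the value by the corresponding power of two. -/
lemma ofDigits_update (a : ℕ → Fin 2) (k : ℕ) (v : Fin 2) :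
    ofDigits (Function.update a k v) =
      ofDigits a + ((v : ℕ) - (a k : ℕ) : ℝ) * ((2 : ℝ) ^ (k + 1))⁻¹ := by
  have h := (summable_ofDigitsTerm (digits := a)).hasSum.update k
    (((v : ℕ) : ℝ) * ((2 : ℝ) ^ (k + 1))⁻¹)
  have e : Function.update (ofDigitsTerm a) k (((v : ℕ) : ℝ) * ((2 : ℝ) ^ (k + 1))⁻¹) =
      ofDigitsTerm (Function.update a k v) := by
    ext i
    by_cases hi : i = k
    · subst hi; simp [ofDigitsTerm]
    · simp [ofDigitsTerm, hi]
  rw [e] at h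
  rw [ofDigits, h.tsum_eq, ofDigits]
  simp only [ofDigitsTerm]
  push_cast
  ring

/-- Two binary expansions that first differ at the digit `N` and share a later zero digit `g`
are quantitatively separated. -/
lemma ofDigits_gap {a c : ℕ → Fin 2} {N g : ℕ} (h : ∀ i < N, a i = c i) (hN : a N ≠ c N)
    (hg : N < g) (ha : a g = 0) (hc : c g = 0) :
    ((2 : ℝ) ^ (g + 1))⁻¹ ≤ |ofDigits a - ofDigits c| := by
  wlog hac : a N = 1 ∧ c N = 0 generalizing a c
  · rw [abs_sub_comm]
    exact this (fun i hi => (h i hi).symm) hN.symm hc ha (by grind)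
  obtain ⟨haN, hcN⟩ := hac
  refine le_trans ?_ (le_abs_self _)
  have hu := ofDigits_update c g 1
  rw [hc] at hu
  have h1 := ofDigits_eq_sum_add_ofDigits a (N + 1)
  have h2 := ofDigits_eq_sum_add_ofDigits (Function.update c g 1) (N + 1)
  have hs : ∑ i ∈ Finset.range N, ofDigitsTerm (Function.update c g 1) i =
      ∑ i ∈ Finset.range N, ofDigitsTerm a i := by
    refine Finset.sum_congr rfl fun i hi => ?_
    have hi := Finset.mem_range.1 hi
    simp [ofDigitsTerm, h i hi, Function.update_of_ne (show i ≠ g by omega)]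
  rw [Finset.sum_range_succ] at h1 h2
  rw [hs] at h2
  have t1 : ofDigitsTerm a N = ((2 : ℝ) ^ (N + 1))⁻¹ := by simp [ofDigitsTerm, haN]
  have t2 : ofDigitsTerm (Function.update c g 1) N = 0 := by
    simp [ofDigitsTerm, Function.update_of_ne (show N ≠ g by omega), hcN]
  have p : (0 : ℝ) < ((2 : ℝ) ^ (N + 1))⁻¹ := by positivity
  have b1 := mul_nonneg p.le (ofDigits_nonneg fun i => a (i + (N + 1)))
  have b2 := mul_le_of_le_one_right p.le
    (ofDigits_le_one fun i => Function.update c g 1 (i + (N + 1)))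
  rw [t1] at h1
  rw [t2] at h2
  norm_num at hu h1 h2
  linarith

/-- A binary sequence that vanishes at all square positions. -/
def Guarded (a : ℕ → Fin 2) : Prop := ∀ i, IsSquare i → a i = 0

/-- A Lipschitz function which reads off the `k`-th digit of guarded binary expansions. -/
def readDigit (k : ℕ) (x : ℝ) : ℝ :=
  min 1 ((2 : ℝ) ^ ((k + 1) * (k + 1) + 1) *
    Metric.infDist x {y | ∃ a, Guarded a ∧ a k = 0 ∧ ofDigits a = y})

lemma readDigit_nonneg (k : ℕ) (x : ℝ) : 0 ≤ readDigit k x :=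
  le_min zero_le_one (mul_nonneg (by positivity) Metric.infDist_nonneg)

lemma readDigit_le_one (k : ℕ) (x : ℝ) : readDigit k x ≤ 1 := min_le_left _ _

lemma exists_lipschitzWith_readDigit (k : ℕ) : ∃ K, LipschitzWith K (readDigit k) := by
  refine ⟨_, LipschitzWith.const_min (Kf := (2 ^ ((k + 1) * (k + 1) + 1) : NNReal) * 1) ?_ 1⟩
  refine LipschitzWith.of_dist_le_mul fun x y => ?_
  have := (Metric.lipschitz_infDist_pt
    {y | ∃ a, Guarded a ∧ a k = 0 ∧ ofDigits a = y}).dist_le_mul x y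
  rw [Real.dist_eq, ← mul_sub, abs_mul, abs_of_nonneg (by positivity)]
  rw [Real.dist_eq] at this
  push_cast at this ⊢
  rw [mul_assoc]
  gcongr

lemma readDigit_ofDigits (k : ℕ) {a : ℕ → Fin 2} (ha : Guarded a) :
    readDigit k (ofDigits a) = (a k : ℕ) := by
  by_cases hk : a k = 0
  · have : Metric.infDist (ofDigits a) {y | ∃ a, Guarded a ∧ a k = 0 ∧ ofDigits a = y} = 0 :=
      Metric.infDist_zero_of_mem ⟨a, ha, hk, rfl⟩
    simp [readDigit, this, hk]
  · have h1 : a k = 1 := by grind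
    rw [readDigit, h1]
    simp only [Fin.val_one, Nat.cast_one]
    refine min_eq_left ?_
    have : ((2 : ℝ) ^ ((k + 1) * (k + 1) + 1))⁻¹ ≤
        Metric.infDist (ofDigits a) {y | ∃ a, Guarded a ∧ a k = 0 ∧ ofDigits a = y} := by
      rw [Metric.le_infDist ⟨ofDigits (0 : ℕ → Fin 2), by exact ⟨0, fun _ _ => rfl, rfl, rfl⟩⟩]
      rintro _ ⟨c, hc, hck, rfl⟩
      classical
      have hex : ∃ N, a N ≠ c N := ⟨k, by rw [hck]; exact hk⟩
      have hle : Nat.find hex ≤ k := Nat.find_min' hex (by rw [hck]; exact hk)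
      exact ofDigits_gap (fun i hi => not_not.1 (Nat.find_min hex hi)) (Nat.find_spec hex)
        (by nlinarith) (ha _ ⟨_, rfl⟩) (hc _ ⟨_, rfl⟩)
    rwa [inv_le_iff_one_le_mul₀ (by positivity), mul_comm] at this

/-- Two binary sequences (indexed by `Bool`) that vanish at square positions, in which each
sequence carries a copy of the digits of the other one at the predecessors of squares, the
remaining digits being prescribed by `b`. -/
def linked (b : Bool → ℕ → Fin 2) (s : Bool) (i : ℕ) : Fin 2 :=
  if h : IsSquare i then 0
  else if IsSquare (i + 1) then linked b (!s) (Nat.sqrt (i + 1) - 2)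
  else b s i
termination_by i
decreasing_by
  have hi : i ≠ 0 := by rintro rfl; exact h ⟨0, rfl⟩
  have := Nat.sqrt_le_self (i + 1)
  omega

lemma guarded_linked (b : Bool → ℕ → Fin 2) (s : Bool) : Guarded (linked b s) := by
  intro i hi
  rw [linked, dif_pos hi]

/-- The position at which the digit `n` of one sequence is copied in the other one. -/
def copyPos (n : ℕ) : ℕ := (n + 2) * (n + 2) - 1

lemma lt_copyPos (n : ℕ) : n < copyPos n := by
  unfold copyPos
  have : n + 1 < (n + 2) * (n + 2) := by nlinarith
  omega

lemma not_isSquare_of_between {m i : ℕ} (h1 : m * m < i) (h2 : i < (m + 1) * (m + 1)) :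
    ¬ IsSquare i := by
  rintro ⟨j, rfl⟩
  have := Nat.mul_self_lt_mul_self_iff.1 h1
  have := Nat.mul_self_lt_mul_self_iff.1 h2
  omega

lemma linked_copyPos (b : Bool → ℕ → Fin 2) (s : Bool) (n : ℕ) :
    linked b s (copyPos n) = linked b (!s) n := by
  have e : copyPos n + 1 = (n + 2) * (n + 2) := Nat.sub_add_cancel (by nlinarith)
  rw [linked, dif_neg, if_pos ⟨n + 2, e⟩, e, Nat.sqrt_eq, Nat.add_sub_cancel]
  exact not_isSquare_of_between (m := n + 1) (by nlinarith) (by nlinarith)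

lemma continuous_linked : Continuous linked := by
  refine continuous_pi fun s => continuous_pi fun i => ?_
  induction i using Nat.strong_induction_on generalizing s with
  | _ i ih =>
    have hu : (fun b => linked b s i) = fun b => if IsSquare i then 0
        else if IsSquare (i + 1) then linked b (!s) (Nat.sqrt (i + 1) - 2) else b s i := by
      ext b
      rw [linked]
      simp
    rw [hu]
    split_ifs with h1 h2
    · exact continuous_const
    · refine ih _ ?_ _
      have hi : i ≠ 0 := by rintro rfl; exact h1 ⟨0, rfl⟩
      have := Nat.sqrt_le_self (i + 1)
      omega
    · fun_prop

/-- An enumeration of positions of free digits. -/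
def freePos (j : ℕ) : ℕ := j + 2 * Nat.sqrt j + 2

lemma freePos_strictMono : StrictMono freePos := by
  intro i j hij
  have := Nat.sqrt_le_sqrt hij.le
  unfold freePos
  omega

lemma linked_freePos (b : Bool → ℕ → Fin 2) (s : Bool) (j : ℕ) :
    linked b s (freePos j) = b s (freePos j) := by
  have h1 := Nat.sqrt_le j
  have h2 := Nat.sqrt_le_add j
  rw [linked, dif_neg, if_neg] <;>
  · refine not_isSquare_of_between (m := Nat.sqrt j + 1) ?_ ?_ <;> unfold freePos <;> nlinarith

lemma eq_or_exists_first_ne (a c : Bool → ℕ → Fin 2) :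
    a = c ∨ ∃ N s, a s N ≠ c s N ∧ ∀ s, ∀ i < N, a s i = c s i := by
  classical
  by_cases h : ∃ N, ∃ s, a s N ≠ c s N
  · obtain ⟨s, hs⟩ := Nat.find_spec h
    refine Or.inr ⟨_, s, hs, fun s i hi => ?_⟩
    have := Nat.find_min h hi
    push Not at this
    exact this s
  · push Not at h
    exact Or.inl (funext fun s => funext fun i => h i s)

/-- The point of the plane with the binary expansions `a false` and `a true`. -/
def digitPoint (a : Bool → ℕ → Fin 2) : ℝ × ℝ := (ofDigits (a false), ofDigits (a true))

lemma continuous_digitPoint : Continuous digitPoint := by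
  unfold digitPoint
  have := @continuous_ofDigits 2
  fun_prop

lemma abs_sub_le_dist_digitPoint (a c : Bool → ℕ → Fin 2) (s : Bool) :
    |ofDigits (a s) - ofDigits (c s)| ≤ dist (digitPoint a) (digitPoint c) := by
  rw [Prod.dist_eq, ← Real.dist_eq]
  cases s
  · exact le_max_left _ _
  · exact le_max_right _ _

lemma dist_digitPoint_le {a c : Bool → ℕ → Fin 2} {n : ℕ} (h : ∀ s, ∀ i < n, a s i = c s i) :
    dist (digitPoint a) (digitPoint c) ≤ ((2 : ℝ) ^ n)⁻¹ := by
  rw [Prod.dist_eq, Real.dist_eq, Real.dist_eq]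
  have h1 := abs_ofDigits_sub_ofDigits_le (h false)
  have h2 := abs_ofDigits_sub_ofDigits_le (h true)
  push_cast at h1 h2
  exact max_le h1 h2

/-- The digits at the free positions depend in a Hölder way on the point. -/
lemma dist_freeDigits_le {r : ℝ} (hr0 : 0 < r) (hr : r < 1) (b b' : Bool → ℕ → Fin 2) :
    dist (digitPoint fun s j => linked b s (freePos j))
      (digitPoint fun s j => linked b' s (freePos j)) ≤
    2 ^ (5 + 4 / (1 - r)) * dist (digitPoint (linked b)) (digitPoint (linked b')) ^ r := by
  rcases eq_or_exists_first_ne (linked b) (linked b') with h | ⟨N, s, hs, hN⟩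
  · rw [h, dist_self]
    positivity
  classical
  have hex : ∃ j, N ≤ freePos j := ⟨N, by unfold freePos; omega⟩
  obtain ⟨j, hj, hjm⟩ : ∃ j, N ≤ freePos j ∧ ∀ i < j, freePos i < N :=
    ⟨_, Nat.find_spec hex, fun i hi => not_le.1 (Nat.find_min hex hi)⟩
  have hQ := dist_digitPoint_le (a := fun s j => linked b s (freePos j))
    (c := fun s j => linked b' s (freePos j)) (n := j) fun s i hi => hN s _ (hjm i hi)
  set g := (Nat.sqrt N + 1) * (Nat.sqrt N + 1) with hg
  have hP := (ofDigits_gap (hN s) hs (Nat.lt_succ_sqrt N) (guarded_linked b s g ⟨_, hg⟩)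
    (guarded_linked b' s g ⟨_, hg⟩)).trans (abs_sub_le_dist_digitPoint _ _ s)
  refine hQ.trans ?_
  have hP' := Real.rpow_le_rpow (by positivity) hP hr0.le
  refine le_trans ?_ (mul_le_mul_of_nonneg_left hP' (by positivity))
  rw [← Real.rpow_natCast, ← Real.rpow_natCast, ← Real.rpow_neg zero_le_two,
    ← Real.rpow_neg zero_le_two, ← Real.rpow_mul zero_le_two, ← Real.rpow_add zero_lt_two]
  refine Real.rpow_le_rpow_of_exponent_le one_le_two ?_
  have hq : g + 1 ≤ Nat.sqrt j * Nat.sqrt j + 4 * Nat.sqrt j + 5 := by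
    have h2 := Nat.sqrt_le_add j
    have : Nat.sqrt N < Nat.sqrt j + 2 := by
      rw [Nat.sqrt_lt']
      unfold freePos at hj
      nlinarith
    have : Nat.sqrt N + 1 ≤ Nat.sqrt j + 2 := by omega
    nlinarith
  have hj1 : ((Nat.sqrt j * Nat.sqrt j : ℕ) : ℝ) ≤ j := by exact_mod_cast Nat.sqrt_le j
  rw [hg] at hq
  have hq' : (((Nat.sqrt N + 1) * (Nat.sqrt N + 1) + 1 : ℕ) : ℝ) ≤
      (Nat.sqrt j : ℝ) * Nat.sqrt j + 4 * Nat.sqrt j + 5 := by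
    exact_mod_cast hq
  push_cast at hj1 hq' ⊢
  set q : ℝ := (Nat.sqrt j : ℝ)
  have hq0 : 0 ≤ q := Nat.cast_nonneg _
  have h1r : 0 < 1 - r := by linarith
  have hsq : 0 ≤ (1 - r) * (q - 2 / (1 - r)) ^ 2 := by positivity
  have he : (1 - r) * (q - 2 / (1 - r)) ^ 2 = (1 - r) * q ^ 2 - 4 * q + 4 / (1 - r) := by
    field_simp
    ring
  nlinarith [mul_le_mul_of_nonneg_left hq' hr0.le, mul_nonneg h1r.le hq0]

/-- The set of points all of whose digits are given by linked sequences. -/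
def linkedSet : Set (ℝ × ℝ) := range fun b => digitPoint (linked b)

lemma isCompact_linkedSet : IsCompact linkedSet :=
  isCompact_range (continuous_digitPoint.comp continuous_linked)

lemma dimH_le_two (s : Set (ℝ × ℝ)) : dimH s ≤ 2 := by
  refine (dimH_mono (subset_univ s)).trans ?_
  rw [Real.dimH_univ_eq_finrank]
  simp

lemma exists_freeDigits_eq {z : ℝ × ℝ} (hz : z ∈ Icc (0 : ℝ) 1 ×ˢ Icc (0 : ℝ) 1) :
    ∃ b, digitPoint (fun s j => linked b s (freePos j)) = z := by
  obtain ⟨a, -, ha⟩ := ofDigits_SurjOn one_lt_two hz.1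
  obtain ⟨c, -, hc⟩ := ofDigits_SurjOn one_lt_two hz.2
  refine ⟨fun s => Function.extend freePos (if s then c else a) 0, ?_⟩
  simp [digitPoint, linked_freePos, freePos_strictMono.injective.extend_apply, ha, hc]

lemma dimH_linkedSet : dimH linkedSet = 2 := by
  refine le_antisymm (dimH_le_two _) ?_
  have key : ∀ r : NNReal, 0 < r → r < 1 → 2 * (r : ENNReal) ≤ dimH linkedSet := by
    intro r hr0 hr1
    have hest := fun b b' => dist_freeDigits_le (NNReal.coe_pos.2 hr0) (r := r)
      (by exact_mod_cast hr1) b b'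
    set P : (Bool → ℕ → Fin 2) → ℝ × ℝ := fun b => digitPoint (linked b) with hP
    set Q : (Bool → ℕ → Fin 2) → ℝ × ℝ := fun b =>
      digitPoint fun s j => linked b s (freePos j) with hQ
    have hinv : ∀ b, P (Function.invFun P (P b)) = P b := fun b =>
      Function.invFun_eq ⟨b, rfl⟩
    have hH : HolderOnWith (Real.toNNReal (2 ^ (5 + 4 / (1 - (r : ℝ))))) r
        (Q ∘ Function.invFun P) linkedSet := by
      rintro _ ⟨b, rfl⟩ _ ⟨b', rfl⟩
      have h := hest (Function.invFun P (P b)) (Function.invFun P (P b'))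
      change dist (Q _) (Q _) ≤ _ * dist (P _) (P _) ^ _ at h
      rw [hinv, hinv] at h
      change edist (Q _) (Q _) ≤ _ * edist (P b) (P b') ^ _
      rw [edist_dist, edist_dist, ENNReal.ofReal_rpow_of_nonneg (p := (r : ℝ))
        (dist_nonneg (x := P b) (y := P b')) r.2]
      refine (ENNReal.ofReal_le_ofReal h).trans_eq ?_
      rw [ENNReal.ofReal_mul (by positivity)]
      rfl
    have hd := hH.dimH_image_le hr0
    have hsub : Icc (0 : ℝ) 1 ×ˢ Icc (0 : ℝ) 1 ⊆ (Q ∘ Function.invFun P) '' linkedSet := by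
      intro z hz
      obtain ⟨b, hb⟩ := exists_freeDigits_eq hz
      refine ⟨P b, ⟨b, rfl⟩, ?_⟩
      have h := hest (Function.invFun P (P b)) b
      change dist (Q _) (Q _) ≤ _ * dist (P _) (P _) ^ _ at h
      rw [hinv, dist_self, Real.zero_rpow (by exact_mod_cast hr0.ne'), mul_zero] at h
      exact (dist_le_zero.1 h).trans hb
    have h2 : dimH (Icc (0 : ℝ) 1 ×ˢ Icc (0 : ℝ) 1) = 2 := by
      rw [Real.dimH_of_nonempty_interior]
      · simp
      · rw [interior_prod_eq, interior_Icc]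
        exact ⟨(1 / 2, 1 / 2), by norm_num, by norm_num⟩
    have h3 := (dimH_mono hsub).trans hd
    rw [h2] at h3
    rwa [ENNReal.le_div_iff_mul_le (by simp [hr0.ne']) (by simp)] at h3
  refine ENNReal.le_of_forall_nnreal_lt fun q hq => ?_
  rcases eq_or_ne q 0 with rfl | h0
  · simp
  have hq2 : q < 2 := by exact_mod_cast hq
  have := key (q / 2) (by positivity) (by rwa [div_lt_one two_pos])
  rwa [← ENNReal.coe_ofNat, ← ENNReal.coe_mul, mul_div_cancel₀ _ two_ne_zero] at this

/-- A `C¹` function with support in `[-4, 4]`, bounded together with its derivative by `C`, and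
such that its derivative is Lipschitz. -/
structure IsProfile (C : ℝ) (A A' : ℝ → ℝ) : Prop where
  hasDerivAt : ∀ x, HasDerivAt A (A' x) x
  eq_zero : ∀ x, 4 ≤ |x| → A x = 0
  deriv_eq_zero : ∀ x, 4 ≤ |x| → A' x = 0
  abs_le : ∀ x, |A x| ≤ C
  abs_deriv_le : ∀ x, |A' x| ≤ C
  lipschitz : ∃ K, LipschitzWith K A
  lipschitz_deriv : ∃ K, LipschitzWith K A'

lemma exists_lipschitzWith_mul {α : Type*} [PseudoMetricSpace α] {f g : α → ℝ} {C : ℝ}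
    (hf : ∃ K, LipschitzWith K f) (hg : ∃ K, LipschitzWith K g) (hfC : ∀ x, |f x| ≤ C)
    (hgC : ∀ x, |g x| ≤ C) : ∃ K, LipschitzWith K fun x => f x * g x := by
  obtain ⟨K, hK⟩ := hf
  obtain ⟨L, hL⟩ := hg
  refine ⟨C.toNNReal * L + C.toNNReal * K, LipschitzWith.of_dist_le_mul fun x y => ?_⟩
  have hC : 0 ≤ C := (abs_nonneg _).trans (hfC x)
  have h1 := hK.dist_le_mul x y
  have h2 := hL.dist_le_mul x y
  rw [Real.dist_eq] at *
  push_cast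
  rw [Real.coe_toNNReal _ hC]
  calc |f x * g x - f y * g y| = |f x * (g x - g y) + g y * (f x - f y)| := by ring_nf
    _ ≤ |f x| * |g x - g y| + |g y| * |f x - f y| := by
        rw [← abs_mul, ← abs_mul]; exact abs_add_le _ _
    _ ≤ C * (L * dist x y) + C * (K * dist x y) := by gcongr <;> grind
    _ = _ := by ring

/-- The velocity field with stream function `A x * B y`. -/
def productFlow (A A' B B' : ℝ → ℝ) (x : ℝ × ℝ) : ℝ × ℝ :=
  (A x.1 * B' x.2, -(A' x.1 * B x.2))

namespace IsProfile

variable {C : ℝ} {A A' B B' : ℝ → ℝ}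

lemma norm_productFlow_le (hA : IsProfile C A A') (hB : IsProfile C B B') (x : ℝ × ℝ) :
    ‖productFlow A A' B B' x‖ ≤ C * C := by
  have hC : 0 ≤ C := (abs_nonneg _).trans (hA.abs_le 0)
  rw [productFlow, Prod.norm_def, norm_neg, norm_mul, norm_mul]
  exact max_le (mul_le_mul (hA.abs_le _) (hB.abs_deriv_le _) (abs_nonneg _) hC)
    (mul_le_mul (hA.abs_deriv_le _) (hB.abs_le _) (abs_nonneg _) hC)

lemma productFlow_eq_zero (hA : IsProfile C A A') (hB : IsProfile C B B') {x : ℝ × ℝ}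
    (hx : 4 ≤ ‖x‖) : productFlow A A' B B' x = 0 := by
  rw [Prod.norm_def, le_max_iff] at hx
  rcases hx with hx | hx
  · simp [productFlow, hA.eq_zero _ hx, hA.deriv_eq_zero _ hx]
  · simp [productFlow, hB.eq_zero _ hx, hB.deriv_eq_zero _ hx]

lemma exists_lipschitzWith_productFlow (hA : IsProfile C A A') (hB : IsProfile C B B') :
    ∃ K, LipschitzWith K (productFlow A A' B B') := by
  have fst : ∀ {f : ℝ → ℝ}, (∃ K, LipschitzWith K f) →
      ∃ K, LipschitzWith K fun x : ℝ × ℝ => f x.1 :=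
    fun ⟨_, h⟩ => ⟨_, h.comp LipschitzWith.prod_fst⟩
  have snd : ∀ {f : ℝ → ℝ}, (∃ K, LipschitzWith K f) →
      ∃ K, LipschitzWith K fun x : ℝ × ℝ => f x.2 :=
    fun ⟨_, h⟩ => ⟨_, h.comp LipschitzWith.prod_snd⟩
  obtain ⟨K, hK⟩ := exists_lipschitzWith_mul (fst hA.lipschitz) (snd hB.lipschitz_deriv)
    (fun _ => hA.abs_le _) (fun _ => hB.abs_deriv_le _)
  obtain ⟨L, hL⟩ := exists_lipschitzWith_mul (fst hA.lipschitz_deriv) (snd hB.lipschitz)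
    (fun _ => hA.abs_deriv_le _) (fun _ => hB.abs_le _)
  exact ⟨_, hK.prodMk hL.neg⟩

lemma integral_productFlow (hA : IsProfile C A A') (hB : IsProfile C B B') {ψ : ℝ × ℝ → ℝ}
    (hψ : ContDiff ℝ (⊤ : ℕ∞) ψ) (hc : HasCompactSupport ψ) :
    ∫ x, dot2 (productFlow A A' B B' x) (grad2 ψ x) = 0 := by
  have cA : Continuous A := let ⟨_, h⟩ := hA.lipschitz; h.continuous
  have cA' : Continuous A' := let ⟨_, h⟩ := hA.lipschitz_deriv; h.continuous
  have cB : Continuous B := let ⟨_, h⟩ := hB.lipschitz; h.continuous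
  have cB' : Continuous B' := let ⟨_, h⟩ := hB.lipschitz_deriv; h.continuous
  have cψ := hψ.continuous
  have cdψ : ∀ v, Continuous fun x => fderiv ℝ ψ x v := fun v =>
    (hψ.continuous_fderiv (by simp)).clm_apply continuous_const
  have sdψ : ∀ v, HasCompactSupport fun x => fderiv ℝ ψ x v := fun v => hc.fderiv_apply ℝ v
  have hline : ∀ v x, HasLineDerivAt ℝ ψ (fderiv ℝ ψ x v) x v := fun v x =>
    (hψ.differentiable (by simp) x).hasFDerivAt.hasLineDerivAt v
  have int : ∀ {f g : ℝ × ℝ → ℝ}, Continuous f → Continuous g → HasCompactSupport g →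
      Integrable fun x => ContinuousLinearMap.mul ℝ ℝ (f x) (g x) := fun hf hg hs =>
    (hf.mul hg).integrable_of_hasCompactSupport hs.mul_left
  have cf1 : Continuous fun x : ℝ × ℝ => A x.1 * B' x.2 := by fun_prop
  have cf2 : Continuous fun x : ℝ × ℝ => A' x.1 * B x.2 := by fun_prop
  have cf3 : Continuous fun x : ℝ × ℝ => A' x.1 * B' x.2 := by fun_prop
  have h1 := integral_bilinear_hasLineDerivAt_right_eq_neg_left_of_integrable (μ := volume)
    (f := fun x : ℝ × ℝ => A x.1 * B' x.2) (f' := fun x => A' x.1 * B' x.2) (v := (1, 0))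
    (g := ψ) (int cf3 cψ hc) (int cf1 (cdψ (1, 0)) (sdψ _)) (int cf1 cψ hc)
    (fun x _ => by
      have := ((hA.hasDerivAt x.1).scomp_of_eq 0 ((hasDerivAt_id (0 : ℝ)).const_add x.1)
        (by simp)).mul_const (B' x.2)
      simpa [HasLineDerivAt, Function.comp_def] using this) (fun x _ => hline _ x)
  have h2 := integral_bilinear_hasLineDerivAt_right_eq_neg_left_of_integrable (μ := volume)
    (f := fun x : ℝ × ℝ => A' x.1 * B x.2) (f' := fun x => A' x.1 * B' x.2) (v := (0, 1))
    (g := ψ) (int cf3 cψ hc) (int cf2 (cdψ (0, 1)) (sdψ _)) (int cf2 cψ hc)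
    (fun x _ => by
      have := ((hB.hasDerivAt x.2).scomp_of_eq 0 ((hasDerivAt_id (0 : ℝ)).const_add x.2)
        (by simp)).const_mul (A' x.1)
      simpa [HasLineDerivAt, Function.comp_def] using this) (fun x _ => hline _ x)
  have i1 := int cf1 (cdψ (1, 0)) (sdψ _)
  have i2 := int cf2 (cdψ (0, 1)) (sdψ _)
  simp only [ContinuousLinearMap.mul_apply'] at h1 h2 i1 i2
  have : ∀ x, dot2 (productFlow A A' B B' x) (grad2 ψ x) =
      A x.1 * B' x.2 * fderiv ℝ ψ x (1, 0) - A' x.1 * B x.2 * fderiv ℝ ψ x (0, 1) := by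
    intro x
    simp only [dot2, productFlow, grad2]
    ring
  simp_rw [this]
  rw [integral_sub i1 i2, h1, h2, sub_self]

end IsProfile

lemma exists_bump_profile : ∃ C χ χ', IsProfile C χ χ' ∧
    ∀ x ∈ Icc (0 : ℝ) 1, χ x = 1 ∧ χ' x = 0 := by
  let χ : ContDiffBump (0 : ℝ) := ⟨2, 3, by norm_num, by norm_num⟩
  have hd : ContDiff ℝ 1 (deriv χ) := by
    have : ContDiff ℝ (1 + 1) χ := χ.contDiff
    exact (contDiff_succ_iff_deriv.1 this).2.2
  have hs := χ.hasCompactSupport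
  obtain ⟨C, hC⟩ := hs.exists_bound_of_continuous χ.continuous
  obtain ⟨C', hC'⟩ := hs.deriv.exists_bound_of_continuous hd.continuous
  refine ⟨max C C', χ, deriv χ, ⟨fun x => ?_, fun x hx => ?_, fun x hx => ?_,
    fun x => (hC x).trans (le_max_left _ _), fun x => (hC' x).trans (le_max_right _ _),
    ContDiff.lipschitzWith_of_hasCompactSupport hs (χ.contDiff (n := 1)) one_ne_zero,
    ContDiff.lipschitzWith_of_hasCompactSupport hs.deriv hd one_ne_zero⟩, fun x hx => ⟨?_, ?_⟩⟩
  · exact ((χ.contDiff (n := 1)).differentiable one_ne_zero x).hasDerivAt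
  · refine χ.zero_of_le_dist ?_
    rw [Real.dist_eq, sub_zero]
    exact le_trans (by norm_num) hx
  · by_contra h
    have : x ∈ tsupport χ := support_deriv_subset h
    rw [χ.tsupport_eq, Metric.mem_closedBall, Real.dist_eq, sub_zero] at this
    change |x| ≤ 3 at this
    linarith
  · refine χ.one_of_mem_closedBall ?_
    rw [Metric.mem_closedBall, Real.dist_eq, sub_zero, abs_of_nonneg hx.1]
    exact hx.2.trans (by norm_num)
  · have hb : x ∈ Metric.ball (0 : ℝ) χ.rIn := by
      rw [Metric.mem_ball, Real.dist_eq, sub_zero, abs_of_nonneg hx.1]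
      exact hx.2.trans_lt (by norm_num)
    rw [(χ.eventuallyEq_one_of_mem_ball hb).deriv_eq]
    exact deriv_const x (1 : ℝ)

lemma exists_profile : ∃ C χ χ', IsProfile C χ χ' ∧
    (∀ x ∈ Icc (0 : ℝ) 1, χ x = 1 ∧ χ' x = 0) ∧
    ∀ f : ℝ → ℝ, (∃ K, LipschitzWith K f) → (∀ x, 0 ≤ f x) → (∀ x, f x ≤ 1) →
      ∃ G G', IsProfile C G G' ∧ ∀ x ∈ Icc (0 : ℝ) 1, G' x = f x := by
  obtain ⟨C, χ, χ', h, h1⟩ := exists_bump_profile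
  have hC : 0 ≤ C := (abs_nonneg _).trans (h.abs_le 0)
  refine ⟨5 * C, χ, χ', ⟨h.1, h.2, h.3, fun x => (h.4 x).trans (by linarith),
    fun x => (h.5 x).trans (by linarith), h.6, h.7⟩, h1, fun f hf hf0 hf1 => ?_⟩
  have cf : Continuous f := let ⟨_, h⟩ := hf; h.continuous
  have hfabs : ∀ x, |f x| ≤ 1 := fun x => abs_le.2 ⟨by linarith [hf0 x], hf1 x⟩
  set F : ℝ → ℝ := fun x => ∫ t in (0 : ℝ)..x, f t
  have hF : ∀ x, HasDerivAt F (f x) x := fun x =>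
    intervalIntegral.integral_hasDerivAt_right (cf.intervalIntegrable _ _)
      (cf.stronglyMeasurableAtFilter _ _) cf.continuousAt
  have hFL : LipschitzWith 1 F := lipschitzWith_of_nnnorm_deriv_le
    (fun x => (hF x).differentiableAt) fun x => by
      rw [(hF x).deriv, ← NNReal.coe_le_coe]; exact hfabs x
  have hFx : ∀ x, |F x| ≤ |x| := fun x => by
    have := hFL.dist_le_mul x 0
    simpa [F, Real.dist_eq] using this
  set c : ℝ → ℝ := fun x => max (-4) (min 4 x)
  have hcL : LipschitzWith 1 c := (LipschitzWith.id.const_min 4).const_max (-4)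
  have hc4 : ∀ x, |c x| ≤ 4 := fun x =>
    abs_le.2 ⟨le_max_left _ _, max_le (by norm_num) (min_le_left _ _)⟩
  have hcx : ∀ x, |x| < 4 → c x = x := fun x hx => by
    rw [abs_lt] at hx
    simp only [c]
    rw [min_eq_right hx.2.le, max_eq_right hx.1.le]
  have hFc4 : ∀ x, |F (c x)| ≤ 4 := fun x => (hFx _).trans (hc4 x)
  have hFcL : ∃ K, LipschitzWith K (fun x => F (c x)) := ⟨_, hFL.comp hcL⟩
  have eqF : ∀ g : ℝ → ℝ, (∀ x, 4 ≤ |x| → g x = 0) →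
      (fun x => g x * F x) = fun x => g x * F (c x) := fun g hg => funext fun x => by
    rcases le_or_gt 4 |x| with hx | hx
    · simp [hg x hx]
    · rw [hcx x hx]
  have bnd : ∀ x, |F (c x)| ≤ max 4 C := fun x => (hFc4 x).trans (le_max_left _ _)
  have l1 : ∃ K, LipschitzWith K fun x => χ x * F x := by
    rw [eqF χ h.eq_zero]
    exact exists_lipschitzWith_mul h.lipschitz hFcL (fun x => (h.abs_le x).trans (le_max_right _ _))
      bnd
  have l2 : ∃ K, LipschitzWith K fun x => χ' x * F x := by
    rw [eqF χ' h.deriv_eq_zero]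
    exact exists_lipschitzWith_mul h.lipschitz_deriv hFcL
      (fun x => (h.abs_deriv_le x).trans (le_max_right _ _)) bnd
  obtain ⟨K2, l2⟩ := l2
  obtain ⟨K3, l3⟩ := exists_lipschitzWith_mul h.lipschitz hf
    (fun x => (h.abs_le x).trans (le_max_left C 1)) (fun x => (hfabs x).trans (le_max_right C 1))
  have b1 : ∀ g : ℝ → ℝ, (∀ x, 4 ≤ |x| → g x = 0) → (∀ x, |g x| ≤ C) → ∀ x, |g x * F x| ≤ 4 * C :=
    fun g hg hgC x => by
      rw [congrFun (eqF g hg) x, abs_mul, mul_comm]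
      exact mul_le_mul (hFc4 x) (hgC x) (abs_nonneg _) (by norm_num)
  refine ⟨fun x => χ x * F x, fun x => χ' x * F x + χ x * f x,
    ⟨fun x => (h.hasDerivAt x).mul (hF x), fun x hx => by simp [h.eq_zero x hx],
    fun x hx => by simp [h.eq_zero x hx, h.deriv_eq_zero x hx],
    fun x => (b1 χ h.eq_zero h.abs_le x).trans (by linarith), fun x => ?_, l1, ⟨_, l2.add l3⟩⟩,
    fun x hx => by simp [h1 x hx]⟩
  have e := b1 χ' h.deriv_eq_zero h.abs_deriv_le x
  have e2 : |χ x * f x| ≤ C * 1 := by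
    rw [abs_mul]
    exact mul_le_mul (h.abs_le x) (hfabs x) (abs_nonneg _) hC
  exact (abs_add_le _ _).trans (by linarith)

/-- The affine map taking the values `0` and `1` at the ends `m / (m + 1)` and
`(m + 1) / (m + 2)` of the time interval of stage `m`. -/
def stageArg (m : ℕ) (t : ℝ) : ℝ := (m + 2) - (m + 1) * (m + 2) * (1 - t)

/-- The progress made within stage `m` at time `t`. -/
def stageClock (m : ℕ) (t : ℝ) : ℝ := smoothTransition (stageArg m t)

/-- The time derivative of `stageClock`. -/
def stageSpeed (m : ℕ) (t : ℝ) : ℝ := (m + 1) * (m + 2) * deriv smoothTransition (stageArg m t)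

lemma hasDerivAt_stageClock (m : ℕ) (t : ℝ) :
    HasDerivAt (stageClock m) (stageSpeed m t) t := by
  have h1 : HasDerivAt (stageArg m) (((m : ℝ) + 1) * (m + 2)) t := by
    have := (((hasDerivAt_id t).const_sub 1).const_mul (((m : ℝ) + 1) * (m + 2))).const_sub
      ((m : ℝ) + 2)
    convert! this using 1
    ring
  have h2 := ((smoothTransition.contDiff (n := 1)).differentiable one_ne_zero
    (stageArg m t)).hasDerivAt
  have := h2.comp t h1
  rwa [mul_comm] at this

lemma continuous_deriv_smoothTransition : Continuous (deriv smoothTransition) :=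
  (smoothTransition.contDiff (n := 1)).continuous_deriv le_rfl

lemma continuous_stageSpeed (m : ℕ) : Continuous (stageSpeed m) := by
  have := continuous_deriv_smoothTransition
  unfold stageSpeed stageArg
  fun_prop

lemma stageClock_mem (m : ℕ) (t : ℝ) : stageClock m t ∈ Icc (0 : ℝ) 1 :=
  ⟨smoothTransition.nonneg _, smoothTransition.le_one _⟩

lemma stageClock_eq_zero {m : ℕ} {t : ℝ} (h : 1 ≤ (m + 1) * (1 - t)) : stageClock m t = 0 := by
  refine smoothTransition.zero_of_nonpos ?_
  unfold stageArg
  nlinarith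

lemma stageClock_eq_one {m : ℕ} {t : ℝ} (h : (m + 2) * (1 - t) ≤ 1) : stageClock m t = 1 := by
  refine smoothTransition.one_of_one_le ?_
  unfold stageArg
  nlinarith

lemma deriv_smoothTransition_of_nonpos {x : ℝ} (h : x ≤ 0) : deriv smoothTransition x = 0 := by
  refine IsLocalMin.deriv_eq_zero (Filter.Eventually.of_forall fun y => ?_)
  rw [smoothTransition.zero_of_nonpos h]
  exact smoothTransition.nonneg y

lemma deriv_smoothTransition_of_one_le {x : ℝ} (h : 1 ≤ x) : deriv smoothTransition x = 0 := by
  refine IsLocalMax.deriv_eq_zero (Filter.Eventually.of_forall fun y => ?_)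
  rw [smoothTransition.one_of_one_le h]
  exact smoothTransition.le_one y

lemma stageSpeed_ne_zero {m : ℕ} {t : ℝ} (h : stageSpeed m t ≠ 0) :
    (m + 1) * (1 - t) < 1 ∧ 1 < (m + 2) * (1 - t) := by
  constructor <;> by_contra! h1 <;> refine h (mul_eq_zero_of_right _ ?_)
  · refine deriv_smoothTransition_of_nonpos ?_
    unfold stageArg
    nlinarith
  · refine deriv_smoothTransition_of_one_le ?_
    unfold stageArg
    nlinarith

lemma stageClock_of_lt {m i : ℕ} {t : ℝ} (h : stageSpeed m t ≠ 0) (hi : i < m) :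
    stageClock i t = 1 := by
  obtain ⟨h1, h2⟩ := stageSpeed_ne_zero h
  have hi' : (i : ℝ) + 1 ≤ m := by exact_mod_cast hi
  have ht : 0 < 1 - t := pos_of_mul_pos_right (zero_lt_one.trans h2) (by positivity)
  exact stageClock_eq_one (by nlinarith)

lemma stageClock_of_gt {m i : ℕ} {t : ℝ} (h : stageSpeed m t ≠ 0) (hi : m < i) :
    stageClock i t = 0 := by
  obtain ⟨h1, h2⟩ := stageSpeed_ne_zero h
  have hi' : (m : ℝ) + 1 ≤ i := by exact_mod_cast hi
  have ht : 0 < 1 - t := pos_of_mul_pos_right (zero_lt_one.trans h2) (by positivity)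
  exact stageClock_eq_zero (by nlinarith)

/-- At most one stage is active at any given time. -/
lemma exists_stage (t : ℝ) : ∃ m, ∀ i ≠ m, stageSpeed i t = 0 := by
  by_cases h : ∃ m, stageSpeed m t ≠ 0
  · obtain ⟨m, hm⟩ := h
    refine ⟨m, fun i hi => by_contra fun h => ?_⟩
    obtain ⟨h1, h2⟩ := stageSpeed_ne_zero hm
    obtain ⟨h3, h4⟩ := stageSpeed_ne_zero h
    have ht : 0 < 1 - t := pos_of_mul_pos_right (zero_lt_one.trans h2) (by positivity)
    rcases hi.lt_or_gt with hi | hi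
    · have hi' : (i : ℝ) + 1 ≤ m := by exact_mod_cast hi
      nlinarith
    · have hi' : (m : ℝ) + 1 ≤ i := by exact_mod_cast hi
      nlinarith
  · push Not at h
    exact ⟨0, fun i _ => h i⟩

lemma exists_abs_stageSpeed_le :
    ∃ M : NNReal, ∀ m t, |stageSpeed m t| ≤ M * ((m + 1) * (m + 2)) := by
  have hs : HasCompactSupport (deriv smoothTransition) := by
    refine HasCompactSupport.intro (isCompact_Icc (a := (0 : ℝ)) (b := 1)) fun x hx => ?_
    rcases le_or_gt x 0 with h | h
    · exact deriv_smoothTransition_of_nonpos h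
    · exact deriv_smoothTransition_of_one_le (not_lt.1 fun h1 => hx ⟨h.le, h1.le⟩)
  obtain ⟨M, hM⟩ := hs.exists_bound_of_continuous continuous_deriv_smoothTransition
  refine ⟨⟨M, (norm_nonneg _).trans (hM 0)⟩, fun m t => ?_⟩
  rw [stageSpeed, abs_mul, abs_of_nonneg (by positivity), mul_comm]
  exact mul_le_mul_of_nonneg_right (hM _) (by positivity)

/-- A sequence of steady, divergence free, Lipschitz velocity fields with uniformly compact support
whose sizes decay sufficiently fast. -/
structure IsStageSequence (δ : ℕ → ℝ) (W : ℕ → ℝ × ℝ → ℝ × ℝ) : Prop where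
  lipschitz : ∀ m, ∃ K, LipschitzWith K (W m)
  norm_le : ∀ m x, ‖W m x‖ ≤ δ m
  eq_zero : ∀ m x, 4 ≤ ‖x‖ → W m x = 0
  integral : ∀ m (ψ : ℝ × ℝ → ℝ), ContDiff ℝ (⊤ : ℕ∞) ψ → HasCompactSupport ψ →
    ∫ x, dot2 (W m x) (grad2 ψ x) = 0
  summable : Summable fun m : ℕ => ((m : ℝ) + 1) * (m + 2) * δ m

/-- The velocity field which runs the fields `W 0, W 1, …` one after the other on the time
intervals `[m / (m + 1), (m + 1) / (m + 2)]`. -/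
def flowField (W : ℕ → ℝ × ℝ → ℝ × ℝ) (t : ℝ) (x : ℝ × ℝ) : ℝ × ℝ :=
  ∑' m, stageSpeed m t • W m x

lemma flowField_eq {m : ℕ} {t : ℝ} (h : ∀ i ≠ m, stageSpeed i t = 0)
    (W : ℕ → ℝ × ℝ → ℝ × ℝ) (x : ℝ × ℝ) : flowField W t x = stageSpeed m t • W m x :=
  tsum_eq_single m fun i hi => by rw [h i hi, zero_smul]

/-- A path in which the stage `m` moves from `p m` to `p (m + 1)` along `φ m`. -/
structure IsStagePath (W : ℕ → ℝ × ℝ → ℝ × ℝ) (p : ℕ → ℝ × ℝ) (φ : ℕ → ℝ → ℝ × ℝ) : Prop where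
  left : ∀ m, φ m 0 = p m
  right : ∀ m, φ m 1 = p (m + 1)
  hasDerivWithinAt : ∀ m, ∀ s ∈ Icc (0 : ℝ) 1,
    HasDerivWithinAt (φ m) (W m (φ m s)) (Icc (0 : ℝ) 1) s

namespace IsStageSequence

variable {δ : ℕ → ℝ} {W : ℕ → ℝ × ℝ → ℝ × ℝ}

lemma continuous (hW : IsStageSequence δ W) (m : ℕ) : Continuous (W m) :=
  let ⟨_, h⟩ := hW.lipschitz m; h.continuous

lemma exists_summable_bound (hW : IsStageSequence δ W) :
    ∃ u : ℕ → ℝ, Summable u ∧ ∀ m t x, ‖stageSpeed m t • W m x‖ ≤ u m := by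
  obtain ⟨M, hM⟩ := exists_abs_stageSpeed_le
  refine ⟨_, hW.summable.mul_left (M : ℝ), fun m t x => ?_⟩
  rw [norm_smul, ← mul_assoc]
  exact mul_le_mul (hM m t) (hW.norm_le m x) (norm_nonneg _) (by positivity)

lemma continuous_flowField (hW : IsStageSequence δ W) :
    Continuous (Function.uncurry (flowField W)) := by
  obtain ⟨u, hu, h⟩ := hW.exists_summable_bound
  refine continuous_tsum (fun m => ?_) hu fun m x => h m x.1 x.2
  have := hW.continuous m
  have := continuous_stageSpeed m
  fun_prop

lemma hasCompactSupport_flowField (hW : IsStageSequence δ W) :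
    HasCompactSupport (Function.uncurry (flowField W)) := by
  refine HasCompactSupport.intro ((isCompact_Icc (a := (0 : ℝ)) (b := 1)).prod
    (isCompact_closedBall (0 : ℝ × ℝ) 4)) fun x hx => ?_
  obtain ⟨m, hm⟩ := exists_stage x.1
  rw [Function.uncurry, flowField_eq hm]
  by_contra h
  obtain ⟨h1, h2⟩ := smul_ne_zero_iff.1 h
  obtain ⟨h3, h4⟩ := stageSpeed_ne_zero h1
  have ht : 0 < 1 - x.1 := pos_of_mul_pos_right (zero_lt_one.trans h4) (by positivity)
  refine hx ⟨⟨?_, by linarith⟩, ?_⟩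
  · by_contra! h0
    have : (0 : ℝ) ≤ m := Nat.cast_nonneg m
    nlinarith
  · rw [mem_closedBall_zero_iff]
    by_contra! h5
    exact h2 (hW.eq_zero m _ h5.le)

lemma weakDivFreeAt_flowField (hW : IsStageSequence δ W) (t : ℝ) :
    WeakDivFreeAt (flowField W) t := by
  intro ψ hψ hc
  obtain ⟨m, hm⟩ := exists_stage t
  have : ∀ x, dot2 (flowField W t x) (grad2 ψ x) =
      stageSpeed m t * dot2 (W m x) (grad2 ψ x) := fun x => by
    rw [flowField_eq hm]
    simp only [dot2, Prod.smul_fst, Prod.smul_snd, smul_eq_mul]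
    ring
  simp_rw [this]
  rw [integral_const_mul, hW.integral m ψ hψ hc, mul_zero]

lemma exists_lipschitzWith_flowField (hW : IsStageSequence δ W) (t : ℝ) :
    ∃ K, LipschitzWith K (flowField W t) := by
  obtain ⟨m, hm⟩ := exists_stage t
  obtain ⟨K, hK⟩ := hW.lipschitz m
  rw [show flowField W t = fun x => stageSpeed m t • W m x from funext (flowField_eq hm W)]
  exact ⟨_, (lipschitzWith_smul (stageSpeed m t)).comp hK⟩

lemma exists_lipschitzWith_flowField_of_le (hW : IsStageSequence δ W) {t : ℝ} (ht : t < 1) :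
    ∃ K, ∀ s ≤ t, LipschitzWith K (flowField W s) := by
  obtain ⟨M, hM⟩ := exists_abs_stageSpeed_le
  choose K hK using hW.lipschitz
  obtain ⟨N, hN⟩ := exists_nat_gt (1 / (1 - t))
  have ht' : 0 < 1 - t := by linarith
  rw [div_lt_iff₀ ht'] at hN
  refine ⟨∑ m ∈ Finset.range N, M * ((m + 1) * (m + 2)) * K m, fun s hs => ?_⟩
  obtain ⟨m, hm⟩ := exists_stage s
  rw [show flowField W s = fun x => stageSpeed m s • W m x from funext (flowField_eq hm W)]
  by_cases h0 : stageSpeed m s = 0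
  · simp only [h0, zero_smul]
    exact LipschitzWith.const' _
  · refine ((lipschitzWith_smul (stageSpeed m s)).comp (hK m)).weaken ?_
    have hmN : m < N := by
      have h1 := (stageSpeed_ne_zero h0).1
      by_contra! h
      have h : (N : ℝ) ≤ m := by exact_mod_cast h
      nlinarith
    refine le_trans ?_ (Finset.single_le_sum
      (f := fun m : ℕ => M * (((m : NNReal) + 1) * (m + 2)) * K m) (fun _ _ => zero_le)
      (Finset.mem_range.2 hmN))
    refine mul_le_mul_of_nonneg_right ?_ zero_le
    rw [← NNReal.coe_le_coe]
    push_cast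
    exact hM m s

lemma exists_path_of_isStagePath (hW : IsStageSequence δ W) {p : ℕ → ℝ × ℝ}
    {φ : ℕ → ℝ → ℝ × ℝ} (h : IsStagePath W p φ) :
    ∃ X : ℝ → ℝ × ℝ, X 0 = p 0 ∧ (∀ t, HasDerivAt X (flowField W t (X t)) t) ∧
      (Filter.Tendsto p Filter.atTop (nhds 0) → X 1 = 0) := by
  obtain ⟨u, hu, hbound⟩ := hW.exists_summable_bound
  have hd : ∀ m t, HasDerivAt (fun t => φ m (stageClock m t) - p m)
      (stageSpeed m t • W m (φ m (stageClock m t))) t := fun m t =>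
    ((h.hasDerivWithinAt m _ (stageClock_mem m t)).scomp_hasDerivAt t
      (hasDerivAt_stageClock m t) (stageClock_mem m)).sub_const _
  have h0 : ∀ m, φ m (stageClock m 0) - p m = 0 := fun m => by
    rw [stageClock_eq_zero, h.left, sub_self]
    simp
  have hs0 : Summable fun m => φ m (stageClock m 0) - p m := by
    simp_rw [h0]
    exact summable_zero
  refine ⟨fun t => p 0 + ∑' m, (φ m (stageClock m t) - p m), by simp [h0], fun t => ?_,
    fun hp => ?_⟩
  · have key := (hasDerivAt_tsum hu hd (fun m t => hbound m t _) hs0 t).const_add (p 0)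
    convert! key using 1
    obtain ⟨m, hm⟩ := exists_stage t
    rw [flowField_eq hm, tsum_eq_single m fun i hi => by rw [hm i hi, zero_smul]]
    by_cases hmt : stageSpeed m t = 0
    · rw [hmt, zero_smul, zero_smul]
    have hz : ∀ i ∉ Finset.range (m + 1), φ i (stageClock i t) - p i = 0 := fun i hi => by
      rw [stageClock_of_gt hmt (by simpa using hi), h.left, sub_self]
    congr 2
    beta_reduce
    rw [tsum_eq_sum hz, Finset.sum_range_succ,
      Finset.sum_congr rfl fun i hi => by
        rw [stageClock_of_lt hmt (Finset.mem_range.1 hi), h.right], Finset.sum_range_sub]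
    abel
  · have h1 : ∀ m, stageClock m 1 = 1 := fun m => stageClock_eq_one (by simp)
    have hs := (summable_of_summable_hasDerivAt hu hd (fun m t => hbound m t _) hs0
      1).hasSum.tendsto_sum_nat
    simp only [h1, h.right, Finset.sum_range_sub] at hs ⊢
    rw [tendsto_nhds_unique hs (hp.sub_const (p 0))]
    simp

lemma exists_isStagePath (hW : IsStageSequence δ W) (a : ℝ × ℝ) :
    ∃ p φ, IsStagePath W p φ ∧ p 0 = a := by
  have step : ∀ m (x : ℝ × ℝ), ∃ α : ℝ → ℝ × ℝ, α 0 = x ∧ ∀ t ∈ Icc (0 : ℝ) 1,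
      HasDerivWithinAt α (W m (α t)) (Icc (0 : ℝ) 1) t := fun m x => by
    obtain ⟨K, hK⟩ := hW.lipschitz m
    have hδ : 0 ≤ δ m := (norm_nonneg _).trans (hW.norm_le m 0)
    have hP : IsPicardLindelof (fun _ => W m) (tmin := 0) (tmax := 1)
        ⟨0, left_mem_Icc.2 zero_le_one⟩ x ⟨δ m, hδ⟩ 0 ⟨δ m, hδ⟩ K :=
      ⟨fun _ _ => hK.lipschitzOnWith, fun _ _ => continuousOn_const,
        fun _ _ y _ => hW.norm_le m y, by simp⟩
    exact hP.exists_eq_forall_mem_Icc_hasDerivWithinAt₀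
  choose Φ hΦ0 hΦ using step
  let p : ℕ → ℝ × ℝ := fun m => Nat.rec a (fun m x => Φ m x 1) m
  exact ⟨p, fun m => Φ m (p m), ⟨fun m => hΦ0 m _, fun m => rfl, fun m => hΦ m _⟩, rfl⟩

lemma exists_antilipschitzWith (hW : IsStageSequence δ W) {X : ℝ → ℝ × ℝ → ℝ × ℝ}
    (hX0 : ∀ a, X 0 a = a) (hX : ∀ a t, HasDerivAt (fun t => X t a) (flowField W t (X t a)) t)
    {t : ℝ} (ht0 : 0 ≤ t) (ht : t < 1) : ∃ K, AntilipschitzWith K (X t) := by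
  obtain ⟨K, hK⟩ := hW.exists_lipschitzWith_flowField_of_le ht
  have hd : ∀ a s, HasDerivAt (fun s => X (t - s) a) (-flowField W (t - s) (X (t - s) a)) s :=
    fun a s => by
      have := (hX a (t - s)).scomp s ((hasDerivAt_id s).const_sub t)
      rwa [neg_one_smul] at this
  refine ⟨⟨exp (K * t), (exp_pos _).le⟩, AntilipschitzWith.of_le_mul_dist fun a b => ?_⟩
  have := dist_le_of_trajectories_ODE_of_mem (v := fun s x => -flowField W (t - s) x)
    (s := fun _ => univ) (a := 0) (b := t) (K := K) (f := fun s => X (t - s) a)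
    (g := fun s => X (t - s) b) (fun s hs => ((hK _ (by linarith [hs.1])).neg).lipschitzOnWith)
    (fun s _ => (hd a s).continuousAt.continuousWithinAt) (fun s _ => (hd a s).hasDerivWithinAt)
    (fun _ _ => mem_univ _) (fun s _ => (hd b s).continuousAt.continuousWithinAt)
    (fun s _ => (hd b s).hasDerivWithinAt) (fun _ _ => mem_univ _) le_rfl t ⟨ht0, le_rfl⟩
  simpa [hX0, mul_comm] using! this

end IsStageSequence

/-- The sequence `a` with the first `n` digits replaced by `0`. -/
def clearBelow (n : ℕ) (a : ℕ → Fin 2) (i : ℕ) : Fin 2 := if i < n then 0 else a i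

lemma Guarded.clearBelow {a : ℕ → Fin 2} (ha : Guarded a) (n : ℕ) : Guarded (clearBelow n a) :=
  fun i hi => by rw [_root_.clearBelow, ha i hi, ite_self]

lemma clearBelow_of_le {n i : ℕ} (h : n ≤ i) (a : ℕ → Fin 2) : clearBelow n a i = a i :=
  if_neg h.not_gt

lemma ofDigits_clearBelow_succ (n : ℕ) (a : ℕ → Fin 2) :
    ofDigits (clearBelow (n + 1) a) =
      ofDigits (clearBelow n a) - ((2 : ℝ) ^ (n + 1))⁻¹ * (a n : ℕ) := by
  have : clearBelow (n + 1) a = Function.update (clearBelow n a) n 0 := by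
    ext i
    rcases eq_or_ne i n with rfl | hi
    · simp [clearBelow]
    · simp [clearBelow, hi, show i < n + 1 ↔ i < n by omega]
  rw [this, ofDigits_update, clearBelow_of_le le_rfl]
  simp
  ring

lemma tendsto_ofDigits_clearBelow (a : ℕ → Fin 2) :
    Filter.Tendsto (fun n => ofDigits (clearBelow n a)) Filter.atTop (nhds 0) := by
  refine squeeze_zero (fun n => ofDigits_nonneg _) (fun n => ?_)
    (tendsto_pow_atTop_nhds_zero_of_lt_one (r := (2 : ℝ)⁻¹) (by norm_num) (by norm_num))
  have h := abs_ofDigits_sub_ofDigits_le (x := clearBelow n a) (y := 0) (n := n)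
    fun i hi => if_pos hi
  have h0 : ofDigits (0 : ℕ → Fin 2) = 0 := by simp [ofDigits, ofDigitsTerm]
  rw [h0, sub_zero] at h
  rw [inv_pow]
  exact (le_abs_self _).trans (by exact_mod_cast h)

/-- The point `digitPoint a` after `m` steps of alternately clearing the leading digits of the first
and of the second coordinate. -/
def clearedPoint (a : Bool → ℕ → Fin 2) (m : ℕ) : ℝ × ℝ :=
  (ofDigits (clearBelow ((m + 1) / 2) (a false)), ofDigits (clearBelow (m / 2) (a true)))

lemma clearedPoint_mem (a : Bool → ℕ → Fin 2) (m : ℕ) :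
    clearedPoint a m ∈ Icc (0 : ℝ) 1 ×ˢ Icc (0 : ℝ) 1 :=
  ⟨⟨ofDigits_nonneg _, ofDigits_le_one _⟩, ⟨ofDigits_nonneg _, ofDigits_le_one _⟩⟩

lemma clearedPoint_zero (a : Bool → ℕ → Fin 2) : clearedPoint a 0 = digitPoint a := by
  have : ∀ c : ℕ → Fin 2, clearBelow 0 c = c := fun c => funext fun i => if_neg (Nat.not_lt_zero i)
  simp [clearedPoint, digitPoint, this]

lemma tendsto_clearedPoint (a : Bool → ℕ → Fin 2) :
    Filter.Tendsto (clearedPoint a) Filter.atTop (nhds 0) := by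
  refine Filter.Tendsto.prodMk_nhds ((tendsto_ofDigits_clearBelow _).comp ?_)
    ((tendsto_ofDigits_clearBelow _).comp ?_)
  · exact (Nat.tendsto_div_const_atTop two_ne_zero).comp (Filter.tendsto_add_atTop_nat 1)
  · exact Nat.tendsto_div_const_atTop two_ne_zero

lemma summable_stage_bound (C : ℝ) :
    Summable fun m : ℕ => ((m : ℝ) + 1) * (m + 2) * (((2 : ℝ) ^ (m / 2 + 1))⁻¹ * C) := by
  have hb : ∀ m : ℕ, ((2 : ℝ) ^ (m / 2 + 1))⁻¹ ≤ (3 / 4) ^ m := fun m => by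
    rw [show (3 / 4 : ℝ) = (4 / 3)⁻¹ by norm_num, inv_pow]
    refine inv_anti₀ (by positivity) ?_
    calc (4 / 3 : ℝ) ^ m = ((4 / 3) ^ 2) ^ (m / 2) * (4 / 3) ^ (m % 2) := by
          rw [← pow_mul, ← pow_add, Nat.div_add_mod]
      _ ≤ 2 ^ (m / 2) * (4 / 3) ^ 1 := by
          refine mul_le_mul (pow_le_pow_left₀ (by norm_num) (by norm_num) _)
            (pow_le_pow_right₀ (by norm_num) (by omega)) (by positivity) (by positivity)
      _ ≤ 2 ^ (m / 2) * 2 := by gcongr; norm_num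
      _ = 2 ^ (m / 2 + 1) := (pow_succ _ _).symm
  have hr : ‖(3 / 4 : ℝ)‖ < 1 := by norm_num
  have hs := ((summable_pow_mul_geometric_of_norm_lt_one 2 hr).add
    ((summable_pow_mul_geometric_of_norm_lt_one 1 hr).mul_left 3)).add
    ((summable_pow_mul_geometric_of_norm_lt_one 0 hr).mul_left 2)
  have hs' : Summable fun m : ℕ => ((m : ℝ) + 1) * (m + 2) * ((2 : ℝ) ^ (m / 2 + 1))⁻¹ := by
    refine Summable.of_nonneg_of_le (fun m => by positivity) (fun m => ?_) hs
    refine (mul_le_mul_of_nonneg_left (hb m) (by positivity)).trans_eq ?_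
    ring
  simpa only [mul_assoc] using hs'.mul_right C

lemma exists_isStageSequence : ∃ δ W, IsStageSequence δ W ∧
    ∀ n, ∀ x ∈ Icc (0 : ℝ) 1 ×ˢ Icc (0 : ℝ) 1,
      W (2 * n) x = (-(((2 : ℝ) ^ (n + 1))⁻¹ * readDigit (copyPos n) x.2), 0) ∧
      W (2 * n + 1) x = (0, -(((2 : ℝ) ^ (n + 1))⁻¹ * readDigit (copyPos n) x.1)) := by
  obtain ⟨C, χ, χ', hχ, hχ1, hG⟩ := exists_profile
  choose G G' hG hGf using fun n => hG (readDigit (copyPos n)) (exists_lipschitzWith_readDigit _)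
    (readDigit_nonneg _) (readDigit_le_one _)
  let c : ℕ → ℝ := fun m => ((2 : ℝ) ^ (m / 2 + 1))⁻¹
  have hc : ∀ m, 0 ≤ c m := fun m => by positivity
  have main : ∀ (U : ℕ → ℝ × ℝ → ℝ × ℝ), (∀ m, ∃ A A' B B', IsProfile C A A' ∧
      IsProfile C B B' ∧ ∃ σ : ℝ, |σ| ≤ c m ∧ U m = fun x => σ • productFlow A A' B B' x) →
      IsStageSequence (fun m => c m * (C * C)) U := fun U hU => by
    refine ⟨fun m => ?_, fun m x => ?_, fun m x hx => ?_, fun m ψ hψ hs => ?_,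
      summable_stage_bound _⟩ <;> obtain ⟨A, A', B, B', hA, hB, σ, hσ, h⟩ := hU m <;> rw [h]
    · obtain ⟨K, hK⟩ := hA.exists_lipschitzWith_productFlow hB
      exact ⟨_, (lipschitzWith_smul σ).comp hK⟩
    · rw [norm_smul]
      exact mul_le_mul hσ (hA.norm_productFlow_le hB x) (norm_nonneg _) (hc m)
    · simp [hA.productFlow_eq_zero hB hx]
    · have : ∀ x, dot2 (σ • productFlow A A' B B' x) (grad2 ψ x) =
          σ * dot2 (productFlow A A' B B' x) (grad2 ψ x) := fun x => by
        simp only [dot2, Prod.smul_fst, Prod.smul_snd, smul_eq_mul]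
        ring
      simp_rw [this]
      rw [integral_const_mul, hA.integral_productFlow hB hψ hs, mul_zero]
  refine ⟨_, fun m => if Even m then fun x => -c m • productFlow χ χ' (G (m / 2)) (G' (m / 2)) x
    else fun x => c m • productFlow (G (m / 2)) (G' (m / 2)) χ χ' x, main _ fun m => ?_,
    fun n x hx => ⟨?_, ?_⟩⟩
  · by_cases hm : Even m
    · exact ⟨χ, χ', _, _, hχ, hG _, -c m, by rw [abs_neg, abs_of_nonneg (hc m)], if_pos hm⟩
    · exact ⟨_, _, χ, χ', hG _, hχ, c m, by rw [abs_of_nonneg (hc m)], if_neg hm⟩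
  · simp [c, productFlow, hχ1 _ hx.1, hGf n _ hx.2]
  · have h2 : (2 * n + 1) / 2 = n := by omega
    simp [c, productFlow, hχ1 _ hx.2, hGf n _ hx.1, h2]

lemma isStagePath_clearedPoint {W : ℕ → ℝ × ℝ → ℝ × ℝ}
    (hW : ∀ n, ∀ x ∈ Icc (0 : ℝ) 1 ×ˢ Icc (0 : ℝ) 1,
      W (2 * n) x = (-(((2 : ℝ) ^ (n + 1))⁻¹ * readDigit (copyPos n) x.2), 0) ∧
      W (2 * n + 1) x = (0, -(((2 : ℝ) ^ (n + 1))⁻¹ * readDigit (copyPos n) x.1)))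
    (b : Bool → ℕ → Fin 2) :
    IsStagePath W (clearedPoint (linked b)) fun m s => clearedPoint (linked b) m +
      s • (clearedPoint (linked b) (m + 1) - clearedPoint (linked b) m) := by
  refine ⟨fun m => by simp, fun m => by simp, fun m s hs => ?_⟩
  have hmem := ((convex_Icc (0 : ℝ) 1).prod (convex_Icc (0 : ℝ) 1)).add_smul_sub_mem
    (clearedPoint_mem (linked b) m) (clearedPoint_mem (linked b) (m + 1)) hs
  have key : W m (clearedPoint (linked b) m +
      s • (clearedPoint (linked b) (m + 1) - clearedPoint (linked b) m)) =
      clearedPoint (linked b) (m + 1) - clearedPoint (linked b) m := by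
    have read : ∀ s n k, k ≤ copyPos n →
        readDigit (copyPos n) (ofDigits (clearBelow k (linked b s))) = (linked b (!s) n : ℕ) :=
      fun s n k hk => by
        rw [readDigit_ofDigits _ ((guarded_linked b s).clearBelow k), clearBelow_of_le hk,
          linked_copyPos]
    rcases m.even_or_odd' with ⟨n, rfl | rfl⟩
    · rw [(hW n _ hmem).1]
      have h1 : (2 * n + 1) / 2 = n := by omega
      have h2 : (2 * n + 1 + 1) / 2 = n + 1 := by omega
      have h3 : 2 * n / 2 = n := by omega
      simp [clearedPoint, h1, h2, h3, ofDigits_clearBelow_succ, read _ n _ (lt_copyPos n).le]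
    · rw [(hW n _ hmem).2]
      have h1 : (2 * n + 1) / 2 = n := by omega
      have h2 : (2 * n + 1 + 1) / 2 = n + 1 := by omega
      have h3 : (2 * n + 1 + 1 + 1) / 2 = n + 1 := by omega
      have hr := read false n (n + 1) (lt_copyPos n)
      rw [ofDigits_clearBelow_succ] at hr
      simp [clearedPoint, h1, h2, h3, ofDigits_clearBelow_succ, hr]
  rw [key]
  have := (((hasDerivAt_id s).smul_const (clearedPoint (linked b) (m + 1) -
    clearedPoint (linked b) m)).const_add (clearedPoint (linked b) m)).hasDerivWithinAt
    (s := Icc 0 1)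
  simpa using this

/-- There are `T > 0`, a bounded, uniformly continuous, compactly
supported, weakly divergence-free velocity `V` on `[0,T] × ℝ²` with `V t` locally
Lipschitz on `ℝ² \ {0}` for each `t`, a compact set `S` of Hausdorff dimension `2`,
and a trajectory map `X` for `V` on `ℝ²`, such that `X t '' S` has Hausdorff
dimension `2` for every `t ∈ [0,T)` while `X T '' S = {(0,0)}`. -/
theorem statement16 :
    ∃ (T : ℝ) (V : ℝ → ℝ × ℝ → ℝ × ℝ) (S : Set (ℝ × ℝ)) (X : ℝ → ℝ × ℝ → ℝ × ℝ),
      0 < T ∧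
      (∃ C : ℝ, ∀ t ∈ Icc (0 : ℝ) T, ∀ x, ‖V t x‖ ≤ C) ∧
      UniformContinuousOn (Function.uncurry V) (Icc (0 : ℝ) T ×ˢ (univ : Set (ℝ × ℝ))) ∧
      HasCompactSupport (Function.uncurry V) ∧
      (∀ t ∈ Icc (0 : ℝ) T, WeakDivFreeAt V t) ∧
      (∀ t ∈ Icc (0 : ℝ) T,
        LocallyLipschitzOn ({((0 : ℝ), (0 : ℝ))}ᶜ : Set (ℝ × ℝ)) (V t)) ∧
      IsCompact S ∧
      dimH S = 2 ∧
      IsTrajOn T V univ X ∧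
      (∀ t ∈ Ico (0 : ℝ) T, dimH (X t '' S) = 2) ∧
      X T '' S = {((0 : ℝ), (0 : ℝ))} := by
  obtain ⟨δ, W, hW, hread⟩ := exists_isStageSequence
  have path : ∀ a : ℝ × ℝ, ∃ Y : ℝ → ℝ × ℝ, Y 0 = a ∧
      (∀ t, HasDerivAt Y (flowField W t (Y t)) t) ∧ (a ∈ linkedSet → Y 1 = 0) := fun a => by
    by_cases ha : a ∈ linkedSet
    · obtain ⟨b, rfl⟩ := ha
      obtain ⟨Y, h0, hY, h1⟩ := hW.exists_path_of_isStagePath (isStagePath_clearedPoint hread b)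
      exact ⟨Y, h0.trans (clearedPoint_zero _), hY, fun _ => h1 (tendsto_clearedPoint _)⟩
    · obtain ⟨p, φ, h, rfl⟩ := hW.exists_isStagePath a
      obtain ⟨Y, h0, hY, -⟩ := hW.exists_path_of_isStagePath h
      exact ⟨Y, h0, hY, fun h => absurd h ha⟩
  choose Y hY0 hY hY1 using path
  refine ⟨1, flowField W, linkedSet, fun t a => Y a t, one_pos, ?_, ?_,
    hW.hasCompactSupport_flowField, fun t _ => hW.weakDivFreeAt_flowField t, fun t _ => ?_,
    isCompact_linkedSet, dimH_linkedSet,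
    fun a _ => ⟨hY0 a, fun t _ => (hY a t).hasDerivWithinAt⟩, fun t ht => ?_, ?_⟩
  · obtain ⟨C, hC⟩ := hW.hasCompactSupport_flowField.exists_bound_of_continuous
      hW.continuous_flowField
    exact ⟨C, fun t _ x => hC (t, x)⟩
  · exact (hW.hasCompactSupport_flowField.uniformContinuous_of_continuous
      hW.continuous_flowField).uniformContinuousOn
  · obtain ⟨K, hK⟩ := hW.exists_lipschitzWith_flowField t
    exact hK.locallyLipschitz.locallyLipschitzOn
  · obtain ⟨K, hK⟩ := hW.exists_antilipschitzWith (X := fun t a => Y a t) hY0 hY ht.1 ht.2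
    exact le_antisymm (dimH_le_two _) (dimH_linkedSet.symm.le.trans (hK.le_dimH_image _))
  · refine Subset.antisymm ?_ ?_
    · rintro _ ⟨a, ha, rfl⟩
      exact hY1 a ha
    · rintro _ rfl
      exact ⟨digitPoint (linked fun _ _ => 0), ⟨_, rfl⟩, hY1 _ ⟨_, rfl⟩⟩

end
end

section
/- Let I = [−1,1]×{0} ⊂ ℝ² and let H¹_I denote the 1-dimensional Hausdorff measure restricted to I. There exist a compactly supported function κ : ℝ² → ℝ that is continuously differentiable with ∇κ Hölder continuous of exponent 1/2, a map X : [0,∞)×I → ℝ² continuous and differentiable in t, and a time T₀ > 0, such that: X(0,a) = a for all a ∈ I; with K := ∇⊥κ = (−∂₂κ, ∂₁κ), for every a ∈ I and t ≥ 0 one has ∂ₜX(t,a) = ∫_I K(X(t,a) − X(t,α)) dH¹_I(α); and X(t, I) = {(0,0)} for all t ≥ T₀. -/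
open MeasureTheory Set

noncomputable section

/-- The segment `I = [-1,1] × {0}`. -/
def ISeg : Set (ℝ × ℝ) := Icc (-1 : ℝ) 1 ×ˢ ({0} : Set ℝ)

/-- The perpendicular gradient `∇⊥κ = (-∂₂κ, ∂₁κ)`. -/
def perpGrad (κ : ℝ × ℝ → ℝ) (x : ℝ × ℝ) : ℝ × ℝ :=
  (-(fderiv ℝ κ x (0, 1)), fderiv ℝ κ x (1, 0))

/-- A real function is bounded and `1/2`-Hölder, with a common constant. -/
def BddHalfHolder {α : Type*} [PseudoMetricSpace α] (f : α → ℝ) : Prop :=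
  ∃ C : ℝ, 0 ≤ C ∧ (∀ x, |f x| ≤ C) ∧ ∀ x y, |f x - f y| ≤ C * √(dist x y)

namespace BddHalfHolder

variable {α β : Type*} [PseudoMetricSpace α] [PseudoMetricSpace β] {f g : α → ℝ}

theorem add (hf : BddHalfHolder f) (hg : BddHalfHolder g) :
    BddHalfHolder fun x => f x + g x := by
  obtain ⟨C, hC, hC1, hC2⟩ := hf
  obtain ⟨D, hD, hD1, hD2⟩ := hg
  refine ⟨C + D, by positivity, fun x => (abs_add_le _ _).trans (add_le_add (hC1 x) (hD1 x)),
    fun x y => ?_⟩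
  calc |f x + g x - (f y + g y)| = |(f x - f y) + (g x - g y)| := by ring_nf
    _ ≤ |f x - f y| + |g x - g y| := abs_add_le _ _
    _ ≤ C * √(dist x y) + D * √(dist x y) := add_le_add (hC2 x y) (hD2 x y)
    _ = (C + D) * √(dist x y) := by ring

theorem neg (hf : BddHalfHolder f) : BddHalfHolder fun x => -f x := by
  obtain ⟨C, hC, hC1, hC2⟩ := hf
  refine ⟨C, hC, fun x => by simpa using hC1 x, fun x y => ?_⟩
  rw [neg_sub_neg, abs_sub_comm]
  exact hC2 x y

theorem sub (hf : BddHalfHolder f) (hg : BddHalfHolder g) :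
    BddHalfHolder fun x => f x - g x := by
  simpa [sub_eq_add_neg] using hf.add hg.neg

theorem mul (hf : BddHalfHolder f) (hg : BddHalfHolder g) :
    BddHalfHolder fun x => f x * g x := by
  obtain ⟨C, hC, hC1, hC2⟩ := hf
  obtain ⟨D, hD, hD1, hD2⟩ := hg
  refine ⟨C * D + C * D, by positivity, fun x => ?_, fun x y => ?_⟩
  · rw [abs_mul]
    nlinarith [mul_le_mul (hC1 x) (hD1 x) (abs_nonneg _) hC, mul_nonneg hC hD]
  · calc |f x * g x - f y * g y| = |f x * (g x - g y) + (f x - f y) * g y| := by ring_nf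
      _ ≤ |f x| * |g x - g y| + |f x - f y| * |g y| := by
        simpa only [abs_mul] using abs_add_le (f x * (g x - g y)) ((f x - f y) * g y)
      _ ≤ C * (D * √(dist x y)) + C * √(dist x y) * D := by
        gcongr
        exacts [hC1 x, hD2 x y, hC2 x y, hD1 y]
      _ = (C * D + C * D) * √(dist x y) := by ring

theorem comp_lipschitz (hf : BddHalfHolder f) {K : NNReal} {u : β → α} (hu : LipschitzWith K u) :
    BddHalfHolder fun x => f (u x) := by
  obtain ⟨C, hC, hC1, hC2⟩ := hf
  refine ⟨C * (1 + √K), by positivity, fun x => (hC1 _).trans ?_, fun x y => ?_⟩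
  · nlinarith [mul_nonneg hC (Real.sqrt_nonneg K)]
  · calc |f (u x) - f (u y)| ≤ C * √(dist (u x) (u y)) := hC2 _ _
      _ ≤ C * √(K * dist x y) := by gcongr; exact hu.dist_le_mul x y
      _ = C * √K * √(dist x y) := by rw [Real.sqrt_mul K.coe_nonneg]; ring
      _ ≤ C * (1 + √K) * √(dist x y) := by gcongr; linarith

theorem of_lipschitz {K : NNReal} (hf : LipschitzWith K f) {M : ℝ} (hM : ∀ x, |f x| ≤ M) :
    BddHalfHolder f := by
  refine ⟨|M| + √(2 * |M| * K), by positivity,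
    fun x => (hM x).trans ((le_abs_self M).trans (le_add_of_nonneg_right (Real.sqrt_nonneg _))),
    fun x y => ?_⟩
  have h1 : |f x - f y| ≤ K * dist x y := hf.dist_le_mul x y
  have h2 : |f x - f y| ≤ 2 * |M| := by
    have := abs_sub (f x) (f y)
    linarith [hM x, hM y, le_abs_self M]
  calc |f x - f y| ≤ √(2 * |M| * (K * dist x y)) := by
        apply Real.le_sqrt_of_sq_le
        rw [sq]
        exact mul_le_mul h2 h1 (abs_nonneg _) (by positivity)
    _ = √(2 * |M| * K) * √(dist x y) := by rw [← mul_assoc, Real.sqrt_mul (by positivity)]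
    _ ≤ (|M| + √(2 * |M| * K)) * √(dist x y) := by gcongr; linarith [abs_nonneg M]

theorem of_contDiff {f : ℝ → ℝ} (hf : ContDiff ℝ 1 f) (hs : HasCompactSupport f) :
    BddHalfHolder f := by
  obtain ⟨K, hK⟩ := hf.lipschitzWith_of_hasCompactSupport hs (by simp)
  obtain ⟨M, hM⟩ := hs.exists_bound_of_continuous hf.continuous
  exact of_lipschitz hK hM

theorem holderWith_prodMk (hf : BddHalfHolder f) (hg : BddHalfHolder g) :
    ∃ C : NNReal, HolderWith C (1 / 2 : NNReal) fun x => (f x, g x) := by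
  obtain ⟨C, hC, -, hC2⟩ := hf
  obtain ⟨D, hD, -, hD2⟩ := hg
  refine ⟨⟨max C D, le_max_of_le_left hC⟩, fun x y => ?_⟩
  have h : dist (f x, g x) (f y, g y) ≤ max C D * dist x y ^ ((1 / 2 : NNReal) : ℝ) := by
    have hr : dist x y ^ ((1 / 2 : NNReal) : ℝ) = √(dist x y) := by
      rw [Real.sqrt_eq_rpow]; norm_num
    rw [hr, Prod.dist_eq]
    refine max_le ((hC2 x y).trans ?_) ((hD2 x y).trans ?_)
    · gcongr; exact le_max_left _ _
    · gcongr; exact le_max_right _ _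
  rw [edist_dist, edist_dist, ENNReal.ofReal_rpow_of_nonneg dist_nonneg (by positivity)]
  refine (ENNReal.ofReal_le_ofReal h).trans_eq ?_
  rw [ENNReal.ofReal_mul (le_max_of_le_left hC)]
  congr 1
  exact ENNReal.ofReal_eq_coe_nnreal _

end BddHalfHolder

/-- The clamp of `s` to `[0, 2]`. -/
def clampTwo (s : ℝ) : ℝ := max 0 (min s 2)

theorem clampTwo_nonneg (s : ℝ) : 0 ≤ clampTwo s := le_max_left _ _

theorem clampTwo_le (s : ℝ) : clampTwo s ≤ 2 := by simp [clampTwo]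

theorem clampTwo_mono : Monotone clampTwo := fun _ _ h => by unfold clampTwo; gcongr

theorem clampTwo_lipschitz : LipschitzWith 1 clampTwo :=
  (LipschitzWith.id.min_const (2 : ℝ)).const_max 0

/-- A bounded, odd, monotone function which for `ε = 0` is the signed square root on `[-2, 2]`
and which is Lipschitz for `0 < ε`. -/
def signedSqrt (ε s : ℝ) : ℝ := √(clampTwo s + ε) - √(clampTwo (-s) + ε)

theorem signedSqrt_neg (ε s : ℝ) : signedSqrt ε (-s) = -signedSqrt ε s := by
  simp [signedSqrt]

theorem signedSqrt_mono (ε : ℝ) : Monotone (signedSqrt ε) := fun s t h => by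
  unfold signedSqrt
  gcongr
  exacts [clampTwo_mono h, clampTwo_mono (neg_le_neg h)]

theorem signedSqrt_zero_of_mem {s : ℝ} (h0 : 0 ≤ s) (h2 : s ≤ 2) : signedSqrt 0 s = √s := by
  have : min (-s) 2 ≤ 0 := (min_le_left _ _).trans (by linarith)
  simp [signedSqrt, clampTwo, min_eq_left h2, max_eq_right h0, max_eq_left this]

theorem sqrt_add_le_add_sqrt {a b : ℝ} (ha : 0 ≤ a) (hb : 0 ≤ b) : √(a + b) ≤ √a + √b := by
  rw [Real.sqrt_le_iff]
  refine ⟨by positivity, ?_⟩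
  nlinarith [Real.sq_sqrt ha, Real.sq_sqrt hb, mul_nonneg (Real.sqrt_nonneg a) (Real.sqrt_nonneg b)]

theorem abs_sqrt_sub_sqrt_le {a b : ℝ} (ha : 0 ≤ a) (hb : 0 ≤ b) : |√a - √b| ≤ √|a - b| := by
  wlog h : b ≤ a generalizing a b
  · rw [abs_sub_comm, abs_sub_comm a]
    exact this hb ha (le_of_not_ge h)
  rw [abs_of_nonneg (sub_nonneg.2 (Real.sqrt_le_sqrt h)), abs_of_nonneg (sub_nonneg.2 h),
    sub_le_iff_le_add]
  simpa using sqrt_add_le_add_sqrt (sub_nonneg.2 h) hb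

theorem abs_signedSqrt_le {ε : ℝ} (h1 : ε ≤ 1) (s : ℝ) : |signedSqrt ε s| ≤ 2 := by
  have key (t : ℝ) : √(clampTwo t + ε) ≤ 2 :=
    Real.sqrt_le_iff.2 ⟨by norm_num, by linarith [clampTwo_le t]⟩
  exact abs_sub_le_of_nonneg_of_le (Real.sqrt_nonneg _) (key _) (Real.sqrt_nonneg _) (key _)

theorem abs_signedSqrt_sub_le {ε : ℝ} (hε : 0 ≤ ε) (s t : ℝ) :
    |signedSqrt ε s - signedSqrt ε t| ≤ 2 * √(dist s t) := by
  have key (s t : ℝ) : |√(clampTwo s + ε) - √(clampTwo t + ε)| ≤ √(dist s t) := by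
    refine (abs_sqrt_sub_sqrt_le (by linarith [clampTwo_nonneg s])
      (by linarith [clampTwo_nonneg t])).trans (Real.sqrt_le_sqrt ?_)
    simpa [Real.dist_eq] using clampTwo_lipschitz.dist_le_mul s t
  have h := key (-s) (-t)
  rw [dist_neg_neg] at h
  calc |signedSqrt ε s - signedSqrt ε t|
      = |(√(clampTwo s + ε) - √(clampTwo t + ε)) -
          (√(clampTwo (-s) + ε) - √(clampTwo (-t) + ε))| := by unfold signedSqrt; ring_nf
    _ ≤ _ := abs_sub _ _
    _ ≤ 2 * √(dist s t) := by linarith [key s t]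

theorem signedSqrt_bddHalfHolder : BddHalfHolder (signedSqrt 0) :=
  ⟨2, by norm_num, abs_signedSqrt_le zero_le_one, abs_signedSqrt_sub_le le_rfl⟩

theorem signedSqrt_continuous (ε : ℝ) : Continuous (signedSqrt ε) := by
  unfold signedSqrt clampTwo
  fun_prop

theorem signedSqrt_lipschitz {ε : ℝ} (hε : 0 < ε) :
    LipschitzWith (Real.toNNReal (1 / √ε)) (signedSqrt ε) := by
  have key (s t : ℝ) : |√(clampTwo s + ε) - √(clampTwo t + ε)| ≤ 1 / √ε / 2 * |s - t| := by
    have hs : √ε ≤ √(clampTwo s + ε) := Real.sqrt_le_sqrt (by linarith [clampTwo_nonneg s])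
    have ht : √ε ≤ √(clampTwo t + ε) := Real.sqrt_le_sqrt (by linarith [clampTwo_nonneg t])
    have h0 : 0 < √ε := Real.sqrt_pos.2 hε
    have h1 : (√(clampTwo s + ε) - √(clampTwo t + ε)) * (√(clampTwo s + ε) + √(clampTwo t + ε)) =
        clampTwo s - clampTwo t := by
      have := Real.mul_self_sqrt (show 0 ≤ clampTwo s + ε by linarith [clampTwo_nonneg s])
      have := Real.mul_self_sqrt (show 0 ≤ clampTwo t + ε by linarith [clampTwo_nonneg t])
      linarith
    have h2 : |clampTwo s - clampTwo t| ≤ |s - t| := by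
      simpa [Real.dist_eq] using clampTwo_lipschitz.dist_le_mul s t
    rw [← h1, abs_mul, abs_of_nonneg (by positivity : 0 ≤ √(clampTwo s + ε) + _)] at h2
    rw [div_div, one_div_mul_eq_div, le_div_iff₀ (by positivity)]
    refine le_trans ?_ h2
    gcongr
    linarith
  refine LipschitzWith.of_dist_le_mul fun s t => ?_
  rw [Real.coe_toNNReal _ (by positivity), Real.dist_eq, Real.dist_eq]
  have h := key (-s) (-t)
  rw [neg_sub_neg, abs_sub_comm t] at h
  calc |signedSqrt ε s - signedSqrt ε t|
      = |(√(clampTwo s + ε) - √(clampTwo t + ε)) -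
          (√(clampTwo (-s) + ε) - √(clampTwo (-t) + ε))| := by unfold signedSqrt; ring_nf
    _ ≤ _ := abs_sub _ _
    _ ≤ 1 / √ε * |s - t| := by linarith [key s t]

theorem abs_signedSqrt_sub_zero_le {ε : ℝ} (hε : 0 ≤ ε) (s : ℝ) :
    |signedSqrt ε s - signedSqrt 0 s| ≤ 2 * √ε := by
  have key (s : ℝ) : |√(clampTwo s + ε) - √(clampTwo s + 0)| ≤ √ε := by
    refine (abs_sqrt_sub_sqrt_le (by linarith [clampTwo_nonneg s])
      (by linarith [clampTwo_nonneg s])).trans (Real.sqrt_le_sqrt ?_)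
    simp [abs_of_nonneg hε]
  calc |signedSqrt ε s - signedSqrt 0 s|
      = |(√(clampTwo s + ε) - √(clampTwo s + 0)) -
          (√(clampTwo (-s) + ε) - √(clampTwo (-s) + 0))| := by unfold signedSqrt; ring_nf
    _ ≤ _ := abs_sub _ _
    _ ≤ 2 * √ε := by linarith [key s, key (-s)]

section Interaction

theorem abs_integral_interaction_le {J : Type*} [MeasurableSpace J] (μ : Measure J)
    [IsFiniteMeasure μ] {g : ℝ → ℝ} {M : ℝ} (hM : ∀ s, |g s| ≤ M) (x : J → ℝ) (y : ℝ) :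
    |∫ α, g (y - x α) ∂μ| ≤ M * μ.real univ :=
  Real.norm_eq_abs (∫ α, g (y - x α) ∂μ) ▸
    norm_integral_le_of_norm_le_const (ae_of_all _ fun _ => hM _)

open Filter Topology

variable {J : Type*} [MetricSpace J] [MeasurableSpace J] [BorelSpace J]
  (μ : Measure J) [IsFiniteMeasure μ]

theorem continuous_integral_interaction {T : Type*} [TopologicalSpace T] [FirstCountableTopology T]
    {g : ℝ → ℝ} (hg : Continuous g) {M : ℝ} (hM : ∀ s, |g s| ≤ M) {X : T → J → ℝ}
    (hX : Continuous (Function.uncurry X)) :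
    Continuous fun p : T × J => ∫ α, g (X p.1 p.2 - X p.1 α) ∂μ := by
  refine continuous_of_dominated (bound := fun _ => M) (fun p => ?_)
    (fun p => ae_of_all _ fun α => hM _) (integrable_const _) (ae_of_all _ fun α => ?_)
  · exact (hg.comp (continuous_const.sub
      (hX.comp (continuous_const.prodMk continuous_id)))).aestronglyMeasurable
  · exact hg.comp (hX.sub (hX.comp (continuous_fst.prodMk continuous_const)))

variable {g : ℝ → ℝ}

theorem integrable_interaction (hg : Continuous g) {M : ℝ} (hM : ∀ s, |g s| ≤ M) {x : J → ℝ}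
    (hx : Continuous x) (y : ℝ) : Integrable (fun α => g (y - x α)) μ :=
  (integrable_const M).mono' (hg.comp (continuous_const.sub hx)).aestronglyMeasurable
    (ae_of_all _ fun _ => hM _)

/-- Attractive interactions contract mutual distances. -/
theorem antitoneOn_sq_sub_of_interaction (hg : Continuous g) (hanti : Antitone g) {M : ℝ}
    (hM : ∀ s, |g s| ≤ M) {X : ℝ → J → ℝ} {T : ℝ} (hX : ∀ t ∈ Icc 0 T, Continuous (X t))
    (hd : ∀ t ∈ Icc 0 T, ∀ a, HasDerivWithinAt (fun s => X s a)
      (∫ α, g (X t a - X t α) ∂μ) (Icc 0 T) t) (a b : J) :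
    AntitoneOn (fun t => (X t a - X t b) ^ 2) (Icc 0 T) := by
  have hD (t) (ht : t ∈ Icc 0 T) := ((hd t ht a).sub (hd t ht b)).pow 2
  refine antitoneOn_of_hasDerivWithinAt_nonpos (convex_Icc _ _)
    (fun t ht => (hD t ht).continuousWithinAt)
    (fun t ht => (hD t (interior_subset ht)).mono interior_subset) fun t ht => ?_
  have ht := interior_subset ht
  rw [← integral_sub (integrable_interaction μ hg hM (hX t ht) _)
    (integrable_interaction μ hg hM (hX t ht) _)]
  simp only [Nat.cast_ofNat, Nat.add_one_sub_one, pow_one, Pi.sub_apply]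
  rcases le_total (X t a) (X t b) with h | h
  · refine mul_nonpos_of_nonpos_of_nonneg (by linarith) (integral_nonneg fun α => ?_)
    exact sub_nonneg.2 (hanti (by linarith))
  · refine mul_nonpos_of_nonneg_of_nonpos (by linarith) (integral_nonpos fun α => ?_)
    exact sub_nonpos.2 (hanti (by linarith))

variable [CompactSpace J]

/-- The velocity field on configurations `x : J → ℝ` generated by the pair interaction `g`. -/
def interactionField (hg : Continuous g) (hM : ∃ M, ∀ s, |g s| ≤ M) (x : C(J, ℝ)) :
    C(J, ℝ) where
  toFun a := ∫ α, g (x a - x α) ∂μ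
  continuous_toFun := by
    obtain ⟨M, hM⟩ := hM
    exact (continuous_integral_interaction μ hg hM (X := fun _ : Unit => x)
      (x.continuous.comp continuous_snd)).comp (continuous_const.prodMk continuous_id :
        Continuous fun a : J => ((), a))

theorem interactionField_lipschitz {K : NNReal} (hg : LipschitzWith K g)
    (hM : ∃ M, ∀ s, |g s| ≤ M) :
    LipschitzWith (2 * K * (μ univ).toNNReal) (interactionField μ hg.continuous hM) := by
  refine LipschitzWith.of_dist_le_mul fun x y => ?_
  rw [ContinuousMap.dist_le (by positivity)]
  intro a
  obtain ⟨M, hM'⟩ := hM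
  change dist (∫ α, g (x a - x α) ∂μ) (∫ α, g (y a - y α) ∂μ) ≤ _
  rw [dist_eq_norm, ← integral_sub (integrable_interaction μ hg.continuous hM' x.continuous _)
    (integrable_interaction μ hg.continuous hM' y.continuous _)]
  have key : ∀ᵐ α ∂μ, ‖g (x a - x α) - g (y a - y α)‖ ≤ K * (2 * dist x y) := by
    refine ae_of_all _ fun α => ?_
    rw [← dist_eq_norm]
    refine (hg.dist_le_mul _ _).trans ?_
    gcongr
    calc dist (x a - x α) (y a - y α) ≤ dist (x a) (y a) + dist (x α) (y α) :=
          dist_sub_sub_le _ _ _ _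
      _ ≤ dist x y + dist x y := add_le_add (ContinuousMap.dist_apply_le_dist a)
          (ContinuousMap.dist_apply_le_dist α)
      _ = 2 * dist x y := by ring
  refine (norm_integral_le_of_norm_le_const key).trans_eq ?_
  push_cast
  rw [Measure.real, ENNReal.toReal]
  ring

/-- Existence of the flow for a Lipschitz interaction. -/
theorem exists_interaction_flow {K : NNReal} (hg : LipschitzWith K g) {M : ℝ}
    (hM : ∀ s, |g s| ≤ M) (x₀ : C(J, ℝ)) {T : ℝ} (hT : 0 ≤ T) :
    ∃ x : ℝ → C(J, ℝ), x 0 = x₀ ∧ ∀ t ∈ Icc 0 T,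
      HasDerivWithinAt x (interactionField μ hg.continuous ⟨M, hM⟩ (x t)) (Icc 0 T) t := by
  have hM0 : 0 ≤ M := (abs_nonneg _).trans (hM 0)
  have hB : 0 ≤ M * μ.real univ := by positivity
  have hP : IsPicardLindelof (fun _ => interactionField μ hg.continuous ⟨M, hM⟩)
      (⟨0, left_mem_Icc.2 hT⟩ : Icc 0 T) x₀ ⟨M * μ.real univ * T, mul_nonneg hB hT⟩ 0
      ⟨M * μ.real univ, hB⟩ (2 * K * (μ univ).toNNReal) := by
    refine .of_time_independent (fun x _ => ?_)
      ((interactionField_lipschitz μ hg ⟨M, hM⟩).lipschitzOnWith) ?_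
    · rw [ContinuousMap.norm_le _ (by positivity)]
      exact fun a => abs_integral_interaction_le μ hM x _
    · simp only [sub_zero, sub_self, NNReal.coe_zero, max_eq_left hT]
      exact le_rfl
  exact hP.exists_eq_forall_mem_Icc_hasDerivWithinAt₀

theorem integral_integral_odd_eq_zero (hg : Continuous g) {M : ℝ}
    (hM : ∀ s, |g s| ≤ M) (hodd : ∀ s, g (-s) = -g s) {x : J → ℝ} (hx : Continuous x) :
    ∫ a, ∫ α, g (x a - x α) ∂μ ∂μ = 0 := by
  have hint : Integrable (Function.uncurry fun a α => g (x a - x α)) (μ.prod μ) :=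
    (integrable_const M).mono' (hg.comp ((hx.comp continuous_fst).sub
      (hx.comp continuous_snd))).aestronglyMeasurable (ae_of_all _ fun _ => hM _)
  have h := integral_integral_swap hint
  have h2 : ∫ a, ∫ α, g (x α - x a) ∂μ ∂μ = -∫ a, ∫ α, g (x a - x α) ∂μ ∂μ := by
    simp_rw [← integral_neg, ← hodd, neg_sub]
  linarith

/-- Odd interactions preserve the centre of mass. -/
theorem integral_eq_of_interaction_flow (hg : Continuous g) {M : ℝ}
    (hM : ∀ s, |g s| ≤ M) (hodd : ∀ s, g (-s) = -g s) {x : ℝ → C(J, ℝ)} {T : ℝ}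
    (hd : ∀ t ∈ Icc 0 T,
      HasDerivWithinAt x (interactionField μ hg ⟨M, hM⟩ (x t)) (Icc 0 T) t)
    {t : ℝ} (ht : t ∈ Icc 0 T) : ∫ a, x t a ∂μ = ∫ a, x 0 a ∂μ := by
  have hint (y : C(J, ℝ)) : Integrable y μ :=
    y.continuous.integrable_of_hasCompactSupport (HasCompactSupport.of_compactSpace _)
  let L : C(J, ℝ) →L[ℝ] ℝ := LinearMap.mkContinuous
    { toFun := fun y => ∫ a, y a ∂μ
      map_add' := fun y z => integral_add (hint y) (hint z)
      map_smul' := fun c y => integral_const_mul c y } (μ.real univ) fun y => by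
    rw [mul_comm]
    exact norm_integral_le_of_norm_le_const (ae_of_all _ fun a => y.norm_coe_le_norm a)
  have hL (s) (hs : s ∈ Icc 0 T) : HasDerivWithinAt (fun r => L (x r)) 0 (Icc 0 T) s := by
    have h := L.hasFDerivAt.comp_hasDerivWithinAt s (hd s hs)
    have h0 : L (interactionField μ hg ⟨M, hM⟩ (x s)) = 0 :=
      integral_integral_odd_eq_zero μ hg hM hodd (x s).continuous
    rwa [h0] at h
  have h0 : (0 : ℝ) ∈ Icc 0 T := left_mem_Icc.2 (ht.1.trans ht.2)
  have h := (convex_Icc 0 T).norm_image_sub_le_of_norm_hasDerivWithin_le (C := 0) hL (by simp) h0 ht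
  rw [zero_mul, norm_le_zero_iff, sub_eq_zero] at h
  exact h

/-- Existence of the flow, with all its symmetries, for a uniform limit of Lipschitz odd attractive
interactions. -/
theorem exists_interaction_flow_of_tendstoUniformly {f : ℝ → ℝ} (hf : Continuous f)
    {g : ℕ → ℝ → ℝ} (hg : ∀ n, ∃ K, LipschitzWith K (g n)) (hanti : ∀ n, Antitone (g n))
    (hodd : ∀ n s, g n (-s) = -g n s) {M : ℝ} (hM : ∀ n s, |g n s| ≤ M)
    (hlim : TendstoUniformly g f atTop) (x₀ : C(J, ℝ)) {T : ℝ} (hT : 0 ≤ T) :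
    ∃ X : ℝ → J → ℝ, Continuous (Function.uncurry X) ∧ (∀ a, X 0 a = x₀ a) ∧
      (∀ t, T ≤ t → X t = X T) ∧
      (∀ t ∈ Icc 0 T, ∀ a, HasDerivWithinAt (fun s => X s a)
        (∫ α, f (X t a - X t α) ∂μ) (Icc 0 T) t) ∧
      ∀ t ∈ Icc 0 T, ∫ a, X t a ∂μ = ∫ a, x₀ a ∂μ := by
  choose K hK using hg
  choose x hx0 hxd using fun n => exists_interaction_flow μ (hK n) (hM n) x₀ hT
  have h0T : (0 : ℝ) ∈ Icc 0 T := left_mem_Icc.2 hT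
  have hM0 : 0 ≤ M := (abs_nonneg _).trans (hM 0 0)
  have hfM (s) : |f s| ≤ M := le_of_tendsto (hlim.tendsto_at s).abs (Eventually.of_forall (hM · s))
  have heval (n) (t) (ht : t ∈ Icc 0 T) (a : J) : HasDerivWithinAt (fun s => x n s a)
      (∫ α, g n (x n t a - x n t α) ∂μ) (Icc 0 T) t :=
    (ContinuousMap.evalCLM ℝ a : C(J, ℝ) →L[ℝ] ℝ).hasFDerivAt.comp_hasDerivWithinAt t (hxd n t ht)
  have hxc (n) : ContinuousOn (x n) (Icc 0 T) := fun t ht => (hxd n t ht).continuousWithinAt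
  have htime (n) (t) (ht : t ∈ Icc 0 T) (s) (hs : s ∈ Icc 0 T) (a : J) :
      |x n t a - x n s a| ≤ M * μ.real univ * |t - s| :=
    (convex_Icc 0 T).norm_image_sub_le_of_norm_hasDerivWithin_le (fun r hr => heval n r hr a)
      (fun r hr => abs_integral_interaction_le μ (hM n) (x n r) _) hs ht
  have hspace (n) (t) (ht : t ∈ Icc 0 T) (a b : J) : |x n t a - x n t b| ≤ |x₀ a - x₀ b| := by
    have h := antitoneOn_sq_sub_of_interaction μ (hK n).continuous (hanti n) (hM n)
      (fun t _ => (x n t).continuous) (heval n) a b h0T ht ht.1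
    simpa only [hx0] using sq_le_sq.1 h
  have hbound (n) (t) (ht : t ∈ Icc 0 T) (a : J) : ‖x n t a‖ ≤ M * μ.real univ * T + ‖x₀‖ := by
    have h1 := htime n t ht 0 h0T a
    have h2 : M * μ.real univ * |t - 0| ≤ M * μ.real univ * T := by
      rw [sub_zero, abs_of_nonneg ht.1]
      gcongr
      exact ht.2
    rw [hx0] at h1
    calc ‖x n t a‖ = ‖(x n t a - x₀ a) + x₀ a‖ := by rw [sub_add_cancel]
      _ ≤ ‖x n t a - x₀ a‖ + ‖x₀ a‖ := norm_add_le _ _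
      _ ≤ _ := add_le_add (h1.trans h2) (x₀.norm_coe_le_norm a)
  let F (n : ℕ) : BoundedContinuousFunction (Icc 0 T × J) ℝ := BoundedContinuousFunction.mkOfCompact
    ⟨fun p => x n p.1 p.2, by
      have h : Continuous fun t : Icc 0 T => x n t := (hxc n).domRestrict
      exact continuous_eval.comp ((h.comp continuous_fst).prodMk continuous_snd)⟩
  have hequi (n) (p q : Icc 0 T × J) :
      dist (F n p) (F n q) ≤ M * μ.real univ * |(p.1 : ℝ) - q.1| + |x₀ p.2 - x₀ q.2| :=
    (abs_sub_le _ (x n q.1 p.2) _).trans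
      (add_le_add (htime n _ p.1.2 _ q.1.2 _) (hspace n _ q.1.2 _ _))
  have hcompact : IsCompact (closure (range F)) := by
    refine BoundedContinuousFunction.arzela_ascoli
      (Metric.closedBall 0 (M * μ.real univ * T + ‖x₀‖))
      (isCompact_closedBall _ _) _ ?_ ?_
    · rintro _ p ⟨n, rfl⟩
      rw [mem_closedBall_zero_iff]
      exact hbound n p.1 p.1.2 p.2
    · intro p
      refine Metric.equicontinuousAt_of_continuity_modulus
        (fun q => M * μ.real univ * |(p.1 : ℝ) - q.1| + |x₀ p.2 - x₀ q.2|) ?_ _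
        (Eventually.of_forall ?_)
      · have h : Continuous fun q : Icc 0 T × J =>
            M * μ.real univ * |(p.1 : ℝ) - q.1| + |x₀ p.2 - x₀ q.2| := by fun_prop
        simpa using h.tendsto p
      · rintro q ⟨_, n, rfl⟩
        exact hequi n p q
  obtain ⟨G, -, φ, hφ, hG⟩ :=
    hcompact.tendsto_subseq fun n => subset_closure (mem_range_self (f := F) n)
  let X (t : ℝ) (a : J) : ℝ := G (projIcc 0 T hT t, a)
  have hXc : Continuous (Function.uncurry X) :=
    G.continuous.comp ((continuous_projIcc.comp continuous_fst).prodMk continuous_snd)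
  have hpt (t) (ht : t ∈ Icc 0 T) (a : J) : Tendsto (fun n => x (φ n) t a) atTop (𝓝 (X t a)) := by
    have h := ((continuous_eval_const (⟨t, ht⟩, a)).tendsto G).comp hG
    simp only [X, projIcc_of_mem hT ht]
    exact h
  have hX0 (a) : X 0 a = x₀ a :=
    tendsto_nhds_unique (hpt 0 h0T a) (by simp only [hx0, tendsto_const_nhds])
  have hlim' : TendstoUniformly (fun n => g (φ n)) f atTop :=
    fun u hu => hφ.tendsto_atTop.eventually (hlim u hu)
  have hvel (t) (ht : t ∈ Icc 0 T) (a : J) :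
      Tendsto (fun n => ∫ α, g (φ n) (x (φ n) t a - x (φ n) t α) ∂μ) atTop
        (𝓝 (∫ α, f (X t a - X t α) ∂μ)) := by
    refine tendsto_integral_of_dominated_convergence (fun _ => M) (fun n => ?_)
      (integrable_const _) (fun n => ae_of_all _ fun α => hM _ _) (ae_of_all _ fun α => ?_)
    · exact (integrable_interaction μ (hK _).continuous (hM _) (x (φ n) t).continuous _).1
    · exact hlim'.tendsto_comp hf.continuousAt ((hpt t ht a).sub (hpt t ht α))
  have hvc (a : J) : Continuous fun t => ∫ α, f (X t a - X t α) ∂μ :=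
    (continuous_integral_interaction μ hf hfM hXc).comp (continuous_id.prodMk continuous_const)
  have hXint (t) (ht : t ∈ Icc 0 T) (a : J) :
      X t a = x₀ a + ∫ s in (0 : ℝ)..t, ∫ α, f (X s a - X s α) ∂μ := by
    have hsub : Icc 0 t ⊆ Icc 0 T := Icc_subset_Icc_right ht.2
    have hcont (n) : ContinuousOn (fun s => ∫ α, g n (x n s a - x n s α) ∂μ) (Icc 0 T) :=
      (ContinuousMap.evalCLM ℝ a : C(J, ℝ) →L[ℝ] ℝ).continuous.comp_continuousOn
        ((interactionField_lipschitz μ (hK n) ⟨M, hM n⟩).continuous.comp_continuousOn (hxc n))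
    have hint (n) : x n t a = x₀ a + ∫ s in (0 : ℝ)..t, ∫ α, g n (x n s a - x n s α) ∂μ := by
      rw [intervalIntegral.integral_eq_sub_of_hasDeriv_right_of_le ht.1
        (f := fun s => x n s a), hx0]
      · ring
      · exact fun s hs => ((heval n s (hsub hs) a).continuousWithinAt).mono hsub
      · intro s hs
        refine ((heval n s (hsub (Ioo_subset_Icc_self hs)) a).hasDerivAt
          (Icc_mem_nhds hs.1 (hs.2.trans_le ht.2))).hasDerivWithinAt
      · exact ((hcont n).mono hsub).intervalIntegrable_of_Icc ht.1
    refine tendsto_nhds_unique (hpt t ht a) ?_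
    simp_rw [hint]
    refine tendsto_const_nhds.add
      (intervalIntegral.tendsto_integral_filter_of_dominated_convergence
        (fun _ => M * μ.real univ) (Eventually.of_forall fun n => ?_)
        (Eventually.of_forall fun n => ae_of_all _ fun s _ =>
          abs_integral_interaction_le μ (hM _) _ _)
        intervalIntegrable_const (ae_of_all _ fun s hs => ?_))
    · rw [uIoc_of_le ht.1]
      exact (((hcont _).mono hsub).mono Ioc_subset_Icc_self).aestronglyMeasurable measurableSet_Ioc
    · rw [uIoc_of_le ht.1] at hs
      exact hvel s (hsub (Ioc_subset_Icc_self hs)) a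
  refine ⟨X, hXc, hX0, fun t ht => ?_, fun t ht a => ?_, fun t ht => ?_⟩
  · ext a
    simp only [X, projIcc_of_right_le hT ht, projIcc_right]
  · have h := ((hvc a).integral_hasStrictDerivAt 0 t).hasDerivAt.const_add (x₀ a)
    exact h.hasDerivWithinAt.congr (fun s hs => hXint s hs a) (hXint t ht a)
  · refine tendsto_nhds_unique ?_ (tendsto_const_nhds (f := atTop (α := ℕ)))
    have h : Tendsto (fun n => ∫ a, x (φ n) t a ∂μ) atTop (𝓝 (∫ a, X t a ∂μ)) := by
      refine tendsto_integral_of_dominated_convergence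
        (fun _ => M * μ.real univ * T + ‖x₀‖)
        (fun n => (x (φ n) t).continuous.aestronglyMeasurable) (integrable_const _)
        (fun n => ae_of_all _ fun a => hbound _ t ht a) (ae_of_all _ fun a => hpt t ht a)
    refine h.congr fun n => ?_
    rw [integral_eq_of_interaction_flow μ (hK _).continuous (hM _) (hodd _) (hxd _) ht, hx0]

end Interaction

/-- A smooth cutoff which equals `1` on `[-2, 2]`. -/
def cutoff : ContDiffBump (0 : ℝ) := ⟨2, 3, by norm_num, by norm_num⟩

theorem cutoff_contDiff {n : ℕ∞} : ContDiff ℝ n cutoff := cutoff.contDiff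

theorem cutoff_eq_one {s : ℝ} (hs : |s| ≤ 2) : cutoff s = 1 :=
  cutoff.one_of_mem_closedBall (by simpa [cutoff] using hs)

theorem cutoff_hasDerivAt (s : ℝ) : HasDerivAt cutoff (deriv cutoff s) s :=
  ((cutoff_contDiff (n := 1)).differentiable (by simp) s).hasDerivAt

theorem deriv_cutoff_contDiff : ContDiff ℝ 1 (deriv cutoff) :=
  ((contDiff_succ_iff_deriv (n := 1)).1 (cutoff_contDiff (n := 2))).2.2

/-- The primitive of `signedSqrt 0`. -/
def sqrtPrimitive (s : ℝ) : ℝ := ∫ r in (0 : ℝ)..s, signedSqrt 0 r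

theorem sqrtPrimitive_hasDerivAt (s : ℝ) : HasDerivAt sqrtPrimitive (signedSqrt 0 s) s :=
  ((signedSqrt_continuous 0).integral_hasStrictDerivAt 0 s).hasDerivAt

theorem contDiff_one_of_hasDerivAt {f f' : ℝ → ℝ} (hf : ∀ s, HasDerivAt f (f' s) s)
    (hf' : Continuous f') : ContDiff ℝ 1 f := by
  rw [contDiff_one_iff_deriv]
  refine ⟨fun s => (hf s).differentiableAt, ?_⟩
  rwa [funext fun s => (hf s).deriv]

theorem sqrtPrimitive_contDiff : ContDiff ℝ 1 sqrtPrimitive :=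
  contDiff_one_of_hasDerivAt sqrtPrimitive_hasDerivAt (signedSqrt_continuous 0)

/-- The profile of the ridge functions the kernel is made of. -/
def ridge (s : ℝ) : ℝ := sqrtPrimitive s * cutoff s

/-- The derivative of `ridge`. -/
def ridgeDeriv (s : ℝ) : ℝ := signedSqrt 0 s * cutoff s + sqrtPrimitive s * deriv cutoff s

theorem ridge_hasDerivAt (s : ℝ) : HasDerivAt ridge (ridgeDeriv s) s :=
  (sqrtPrimitive_hasDerivAt s).mul (cutoff_hasDerivAt s)

theorem ridge_contDiff : ContDiff ℝ 1 ridge := sqrtPrimitive_contDiff.mul cutoff_contDiff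

theorem ridge_hasCompactSupport : HasCompactSupport ridge := cutoff.hasCompactSupport.mul_left

theorem ridgeDeriv_bddHalfHolder : BddHalfHolder ridgeDeriv :=
  (signedSqrt_bddHalfHolder.mul (.of_contDiff cutoff_contDiff cutoff.hasCompactSupport)).add
    (.of_contDiff (sqrtPrimitive_contDiff.mul deriv_cutoff_contDiff)
      cutoff.hasCompactSupport.deriv.mul_left)

/-- The kernel potential, an antisymmetric combination of products of functions of `x + y` and
`x - y`. -/
def kernelPotential (z : ℝ × ℝ) : ℝ :=
  ridge (z.1 + z.2) * cutoff (z.1 - z.2) - cutoff (z.1 + z.2) * ridge (z.1 - z.2)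

theorem kernelPotential_contDiff : ContDiff ℝ 1 kernelPotential := by
  have h1 := ridge_contDiff
  have h2 := cutoff_contDiff (n := 1)
  exact
    ((h1.comp (contDiff_fst.add contDiff_snd)).mul (h2.comp (contDiff_fst.sub contDiff_snd))).sub
    ((h2.comp (contDiff_fst.add contDiff_snd)).mul (h1.comp (contDiff_fst.sub contDiff_snd)))

theorem kernelPotential_hasCompactSupport : HasCompactSupport kernelPotential := by
  refine HasCompactSupport.intro (K := Metric.closedBall 0 3) (isCompact_closedBall _ _) ?_
  intro z hz
  have hcut {s : ℝ} (hs : 3 ≤ |s|) : cutoff s = 0 :=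
    cutoff.zero_of_le_dist (by simpa [cutoff] using hs)
  have h : 3 ≤ |z.1 + z.2| ∨ 3 ≤ |z.1 - z.2| := by
    by_contra! h
    rw [abs_lt, abs_lt] at h
    refine hz (mem_closedBall_zero_iff.2 (max_le ?_ ?_)) <;>
      exact abs_le.2 ⟨by linarith, by linarith⟩
  rcases h with h | h <;> simp [kernelPotential, ridge, hcut h]

theorem fderiv_kernelPotential (z v : ℝ × ℝ) :
    fderiv ℝ kernelPotential z v =
      ridgeDeriv (z.1 + z.2) * cutoff (z.1 - z.2) * (v.1 + v.2) +
      ridge (z.1 + z.2) * deriv cutoff (z.1 - z.2) * (v.1 - v.2) -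
      deriv cutoff (z.1 + z.2) * ridge (z.1 - z.2) * (v.1 + v.2) -
      cutoff (z.1 + z.2) * ridgeDeriv (z.1 - z.2) * (v.1 - v.2) := by
  have hu : HasFDerivAt (fun z : ℝ × ℝ => z.1 + z.2)
      (ContinuousLinearMap.fst ℝ ℝ ℝ + ContinuousLinearMap.snd ℝ ℝ ℝ) z :=
    hasFDerivAt_fst.add hasFDerivAt_snd
  have hv : HasFDerivAt (fun z : ℝ × ℝ => z.1 - z.2)
      (ContinuousLinearMap.fst ℝ ℝ ℝ - ContinuousLinearMap.snd ℝ ℝ ℝ) z :=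
    hasFDerivAt_fst.sub hasFDerivAt_snd
  have h := (((ridge_hasDerivAt _).comp_hasFDerivAt z hu).mul
    ((cutoff_hasDerivAt _).comp_hasFDerivAt z hv)).sub
    (((cutoff_hasDerivAt _).comp_hasFDerivAt z hu).mul
    ((ridge_hasDerivAt _).comp_hasFDerivAt z hv))
  have h' : HasFDerivAt kernelPotential _ z := h
  rw [h'.fderiv]
  simp
  ring

theorem grad2_kernelPotential_holder :
    ∃ C : NNReal, HolderWith C (1 / 2 : NNReal) (grad2 kernelPotential) := by
  have hu : LipschitzWith (1 + 1) fun z : ℝ × ℝ => z.1 + z.2 :=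
    LipschitzWith.prod_fst.add LipschitzWith.prod_snd
  have hv : LipschitzWith (1 + 1) fun z : ℝ × ℝ => z.1 - z.2 :=
    LipschitzWith.prod_fst.sub LipschitzWith.prod_snd
  have hr := BddHalfHolder.of_contDiff ridge_contDiff ridge_hasCompactSupport
  have hc := BddHalfHolder.of_contDiff cutoff_contDiff cutoff.hasCompactSupport
  have hc' := BddHalfHolder.of_contDiff deriv_cutoff_contDiff cutoff.hasCompactSupport.deriv
  have h1 := (ridgeDeriv_bddHalfHolder.comp_lipschitz hu).mul (hc.comp_lipschitz hv)
  have h2 := (hr.comp_lipschitz hu).mul (hc'.comp_lipschitz hv)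
  have h3 := (hc'.comp_lipschitz hu).mul (hr.comp_lipschitz hv)
  have h4 := (hc.comp_lipschitz hu).mul (ridgeDeriv_bddHalfHolder.comp_lipschitz hv)
  have hgrad : grad2 kernelPotential = fun z => (_, _) := funext fun z =>
    Prod.ext (fderiv_kernelPotential z _) (fderiv_kernelPotential z _)
  simp only [add_zero, zero_add, sub_zero, zero_sub, mul_one, mul_neg_one, ← sub_eq_add_neg,
    sub_neg_eq_add] at hgrad
  rw [hgrad]
  convert (((h1.add h2).sub h3).sub h4).holderWith_prodMk (((h1.sub h2).sub h3).add h4) using 6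

theorem perpGrad_kernelPotential {s : ℝ} (hs : |s| ≤ 2) :
    perpGrad kernelPotential (s, 0) = (-2 * signedSqrt 0 s, 0) := by
  ext
  · simp [perpGrad, fderiv_kernelPotential, ridge, ridgeDeriv, cutoff_eq_one hs]
    ring
  · simp [perpGrad, fderiv_kernelPotential]
    ring

attribute [local instance] Measure.Subtype.measureSpace

theorem volume_univ_Icc_neg_one_one : volume (univ : Set (Icc (-1 : ℝ) 1)) = 2 := by
  rw [Measure.Subtype.volume_univ measurableSet_Icc.nullMeasurableSet, Real.volume_Icc]
  norm_num

instance : IsFiniteMeasure (volume : Measure (Icc (-1 : ℝ) 1)) :=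
  ⟨by simp [volume_univ_Icc_neg_one_one]⟩

/-- A solution of the one-dimensional aggregation flow for the interaction `-2 * signedSqrt 0`
started from the uniform configuration on `[-1, 1]` collapses to the origin within unit time. -/
theorem aggregation_collapse {X : ℝ → Icc (-1 : ℝ) 1 → ℝ} (hc : Continuous (Function.uncurry X))
    (h0 : ∀ a, X 0 a = a)
    (hd : ∀ t ∈ Icc (0 : ℝ) 1, ∀ a, HasDerivWithinAt (fun s => X s a)
      (∫ α, -2 * signedSqrt 0 (X t a - X t α)) (Icc 0 1) t)
    (hmean : ∫ a, X 1 a = 0) (a : Icc (-1 : ℝ) 1) : X 1 a = 0 := by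
  have hXt (t) : Continuous (X t) := hc.comp (continuous_const.prodMk continuous_id)
  have hg : Continuous fun s => -2 * signedSqrt 0 s := (signedSqrt_continuous 0).const_mul _
  have hM (s) : |-2 * signedSqrt 0 s| ≤ 4 := by
    rw [abs_mul]
    have := abs_signedSqrt_le zero_le_one s
    norm_num
    linarith
  have h01 : (0 : ℝ) ∈ Icc (0 : ℝ) 1 := by simp
  have hmass : (volume : Measure (Icc (-1 : ℝ) 1)).real univ = 2 := by
    simp [measureReal_def, volume_univ_Icc_neg_one_one]
  have hsq (a b) := antitoneOn_sq_sub_of_interaction volume hg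
    (fun s t h => by have := signedSqrt_mono 0 h; dsimp only; linarith) hM (fun t _ => hXt t) hd a b
  have horder {a b : Icc (-1 : ℝ) 1} (hab : (a : ℝ) ≤ b) {t : ℝ} (ht : t ∈ Icc (0 : ℝ) 1) :
      X t a ≤ X t b := by
    by_contra! h
    have hcont : ContinuousOn (fun s => X s b - X s a) (Icc 0 t) := by
      have (c : Icc (-1 : ℝ) 1) : Continuous fun s => X s c :=
        hc.comp (continuous_id.prodMk continuous_const)
      exact ((this b).sub (this a)).continuousOn
    obtain ⟨r, hr, hr0⟩ := intermediate_value_Icc' ht.1 hcont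
      (show (0 : ℝ) ∈ Icc _ _ from ⟨by linarith, by simp only [h0]; linarith⟩)
    have h1 := hsq b a ⟨hr.1, hr.2.trans ht.2⟩ ht hr.2
    simp only [hr0] at h1
    nlinarith
  let l : Icc (-1 : ℝ) 1 := ⟨-1, by simp⟩
  let u : Icc (-1 : ℝ) 1 := ⟨1, by simp⟩
  have hdiam {t : ℝ} (ht : t ∈ Icc (0 : ℝ) 1) : X t u - X t l ≤ 2 := by
    have h1 := hsq u l h01 ht ht.1
    simp only [h0, u, l] at h1
    nlinarith
  have hlu : X 1 u ≤ X 1 l := by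
    by_contra! h
    have hpos {t : ℝ} (ht : t ∈ Icc (0 : ℝ) 1) : 0 < X t u - X t l := by
      have h1 := hsq u l ht (right_mem_Icc.2 zero_le_one) ht.2
      have h2 := horder (a := l) (b := u) (by simp [l, u]) ht
      dsimp only at h1
      nlinarith
    have hspeed {t : ℝ} (ht : t ∈ Icc (0 : ℝ) 1) :
        (∫ α, -2 * signedSqrt 0 (X t u - X t α)) - (∫ α, -2 * signedSqrt 0 (X t l - X t α)) ≤
          -4 * √(X t u - X t l) := by
      have hi (y : ℝ) := integrable_interaction (volume : Measure (Icc (-1 : ℝ) 1)) hg hM (hXt t) y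
      rw [← integral_sub (hi _) (hi _)]
      have hle (α) : -2 * signedSqrt 0 (X t u - X t α) - -2 * signedSqrt 0 (X t l - X t α) ≤
          -2 * √(X t u - X t l) := by
        have hu := horder (a := α) (b := u) α.2.2 ht
        have hl := horder (a := l) (b := α) α.2.1 ht
        have h2 := hdiam ht
        rw [← neg_sub (X t α) (X t l), signedSqrt_neg,
          signedSqrt_zero_of_mem (by linarith) (by linarith),
          signedSqrt_zero_of_mem (by linarith) (by linarith)]
        have := sqrt_add_le_add_sqrt (sub_nonneg.2 hu) (sub_nonneg.2 hl)
        rw [sub_add_sub_cancel] at this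
        linarith
      refine (integral_mono ((hi _).sub (hi _)) (integrable_const _) hle).trans_eq ?_
      rw [integral_const, hmass, smul_eq_mul]
      ring
    have hanti : AntitoneOn (fun t => √(X t u - X t l) + 2 * t) (Icc 0 1) := by
      have hD (t) (ht : t ∈ Icc (0 : ℝ) 1) :=
        (((hd t ht u).sub (hd t ht l)).sqrt (hpos ht).ne').add
          ((hasDerivWithinAt_id t (Icc (0 : ℝ) 1)).const_mul 2)
      refine antitoneOn_of_hasDerivWithinAt_nonpos (convex_Icc _ _)
        (fun t ht => (hD t ht).continuousWithinAt)
        (fun t ht => (hD t (interior_subset ht)).mono interior_subset) fun t ht => ?_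
      have ht := interior_subset ht
      have hs := Real.sqrt_pos.2 (hpos ht)
      have h1 := hspeed ht
      have h2 : ((∫ α, -2 * signedSqrt 0 (X t u - X t α)) -
          (∫ α, -2 * signedSqrt 0 (X t l - X t α))) / (2 * √(X t u - X t l)) ≤ -2 := by
        rw [div_le_iff₀ (by positivity)]
        linarith
      simp only [Pi.sub_apply]
      linarith
    have h1 := hanti h01 (right_mem_Icc.2 zero_le_one) zero_le_one
    simp only [h0, u, l] at h1
    have h2 : √(1 - -1) < 2 := by
      rw [Real.sqrt_lt' (by norm_num)]; norm_num
    linarith [Real.sqrt_nonneg (X 1 u - X 1 l)]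
  have hconst (b) : X 1 b = X 1 l := by
    have h1 : (1 : ℝ) ∈ Icc (0 : ℝ) 1 := by simp
    exact le_antisymm ((horder (b := u) b.2.2 h1).trans hlu) (horder (a := l) b.2.1 h1)
  simp only [hconst, integral_const, hmass, smul_eq_mul] at hmean
  rw [hconst]
  linarith

theorem exists_aggregation_flow : ∃ X : ℝ → Icc (-1 : ℝ) 1 → ℝ,
    Continuous (Function.uncurry X) ∧ (∀ a, X 0 a = a) ∧ (∀ t, 1 ≤ t → ∀ a, X t a = 0) ∧
    (∀ t, 0 ≤ t → ∀ a b, |X t a - X t b| ≤ 2) ∧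
    ∀ t ∈ Ici (0 : ℝ), ∀ a, HasDerivWithinAt (fun s => X s a)
      (∫ α, -2 * signedSqrt 0 (X t a - X t α)) (Ici 0) t := by
  have hpos (n : ℕ) : (0 : ℝ) < 1 / ((n : ℝ) + 1) := by positivity
  have hle (n : ℕ) : (1 : ℝ) / ((n : ℝ) + 1) ≤ 1 := by
    rw [div_le_one (by positivity)]
    linarith [(Nat.cast_nonneg n : (0 : ℝ) ≤ n)]
  have hcont : Continuous fun s => -2 * signedSqrt 0 s := (signedSqrt_continuous 0).const_mul _
  have hanti (ε : ℝ) : Antitone fun s => -2 * signedSqrt ε s :=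
    fun s t h => by have := signedSqrt_mono ε h; dsimp only; linarith
  have hbound {ε : ℝ} (h1 : ε ≤ 1) (s : ℝ) : |-2 * signedSqrt ε s| ≤ 4 := by
    rw [abs_mul]
    have := abs_signedSqrt_le h1 s
    norm_num
    linarith
  have hlim : TendstoUniformly (fun (n : ℕ) s => -2 * signedSqrt (1 / ((n : ℝ) + 1)) s)
      (fun s => -2 * signedSqrt 0 s) Filter.atTop := by
    rw [Metric.tendstoUniformly_iff]
    intro δ hδ
    have h := (tendsto_one_div_add_atTop_nhds_zero_nat (𝕜 := ℝ)).sqrt.const_mul 4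
    rw [Real.sqrt_zero, mul_zero] at h
    filter_upwards [h.eventually (gt_mem_nhds hδ)] with n hn s
    have := abs_signedSqrt_sub_zero_le (hpos n).le s
    rw [dist_comm, Real.dist_eq, ← mul_sub, abs_mul]
    norm_num at this hn ⊢
    linarith
  obtain ⟨X, hXc, hX0, hX1, hXd, hXm⟩ := exists_interaction_flow_of_tendstoUniformly
    (volume : Measure (Icc (-1 : ℝ) 1)) (g := fun n s => -2 * signedSqrt (1 / ((n : ℝ) + 1)) s)
    hcont (fun n => ⟨_, (lipschitzWith_smul (-2 : ℝ)).comp (signedSqrt_lipschitz (hpos n))⟩)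
    (fun n => hanti _) (fun n s => by simp only [signedSqrt_neg, mul_neg])
    (fun n => hbound (hle n)) hlim ⟨Subtype.val, continuous_subtype_val⟩ zero_le_one
  simp only [ContinuousMap.coe_mk] at hX0 hXm
  have hmean : ∫ a : Icc (-1 : ℝ) 1, (a : ℝ) = 0 := by
    rw [integral_subtype measurableSet_Icc fun a : ℝ => a, integral_Icc_eq_integral_Ioc,
      ← intervalIntegral.integral_of_le (by norm_num), integral_id]
    norm_num
  have hzero (a) : X 1 a = 0 :=
    aggregation_collapse hXc hX0 hXd ((hXm 1 (by simp)).trans hmean) a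
  have hzero' (t : ℝ) (ht : 1 ≤ t) (a) : X t a = 0 := by rw [hX1 t ht, hzero]
  refine ⟨X, hXc, hX0, hzero', fun t ht a b => ?_, fun t ht a => ?_⟩
  · rcases le_total t 1 with h | h
    · have h1 := antitoneOn_sq_sub_of_interaction volume hcont (hanti 0)
        (hbound zero_le_one) (X := X)
        (fun t _ => hXc.comp (continuous_const.prodMk continuous_id)) hXd a b
        (show (0 : ℝ) ∈ Icc (0 : ℝ) 1 by simp) ⟨ht, h⟩ ht
      simp only [hX0] at h1
      have h2 : |(a : ℝ) - b| ≤ 2 :=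
        abs_le.2 ⟨by linarith [a.2.1, b.2.2], by linarith [a.2.2, b.2.1]⟩
      exact (sq_le_sq.1 h1).trans h2
    · simp [hzero' t h]
  · have hright (h : 1 ≤ t) : HasDerivWithinAt (fun s => X s a)
        (∫ α, -2 * signedSqrt 0 (X t a - X t α)) (Ici 1) t := by
      have : signedSqrt 0 0 = 0 := by rw [signedSqrt_zero_of_mem le_rfl zero_le_two, Real.sqrt_zero]
      simp only [hzero' t h, sub_self, this, mul_zero, integral_zero]
      exact (hasDerivWithinAt_const t (Ici 1) (0 : ℝ)).congr (fun s hs => hzero' s hs a)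
        (hzero' t h a)
    rcases lt_trichotomy t 1 with h | rfl | h
    · refine (hXd t ⟨ht, h.le⟩ a).mono_of_mem_nhdsWithin ?_
      rw [← Ici_inter_Iic]
      exact inter_mem_nhdsWithin _ (Iic_mem_nhds h)
    · rw [← Icc_union_Ici_eq_Ici zero_le_one]
      exact (hXd 1 (by simp) a).union (hright le_rfl)
    · exact ((hright h.le).hasDerivAt (Ici_mem_nhds h)).hasDerivWithinAt

/-- Integration over `ISeg` is integration over the interval `[-1, 1]`. -/
theorem setIntegral_ISeg (F : ℝ × ℝ → ℝ × ℝ) :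
    ∫ z in ISeg, F z ∂μH[(1 : ℝ)] = ∫ a : Icc (-1 : ℝ) 1, F (a, 0) := by
  have hiso : Isometry fun s : ℝ => (s, (0 : ℝ)) :=
    Isometry.of_dist_eq fun s t => by simp [Prod.dist_eq]
  have hemb : MeasurableEmbedding fun s : ℝ => (s, (0 : ℝ)) :=
    hiso.isClosedEmbedding.measurableEmbedding
  have himage : ISeg = (fun s : ℝ => (s, (0 : ℝ))) '' Icc (-1) 1 := by
    rw [ISeg, prod_singleton]
  have hmap : (μH[(1 : ℝ)] : Measure (ℝ × ℝ)).restrict ISeg =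
      (volume.restrict (Icc (-1 : ℝ) 1)).map fun s : ℝ => (s, (0 : ℝ)) := by
    rw [himage, ← hausdorffMeasure_real, ← hemb.injective.preimage_image (Icc (-1) 1),
      ← hemb.restrict_map, hemb.injective.preimage_image,
      hiso.map_hausdorffMeasure (.inl zero_le_one),
      Measure.restrict_restrict_of_subset (image_subset_range _ _)]
  rw [hmap, hemb.integral_map, integral_subtype measurableSet_Icc fun s : ℝ => F (s, 0)]

/-- There are a compactly supported `C¹` function `κ : ℝ² → ℝ`
whose gradient is `1/2`-Hölder, a map `X : [0,∞) × I → ℝ²` with `X 0 = id`, solving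
`∂ₜ X (t,a) = ∫_I (∇⊥κ) (X(t,a) - X(t,α)) dH¹_I(α)`, and a time `T₀ > 0` with
`X t '' I = {(0,0)}` for all `t ≥ T₀`. -/
theorem statement17 :
    ∃ (κ : ℝ × ℝ → ℝ) (X : ℝ → ℝ × ℝ → ℝ × ℝ) (T₀ : ℝ),
      HasCompactSupport κ ∧
      ContDiff ℝ 1 κ ∧
      (∃ C : NNReal, HolderWith C (1/2 : NNReal) (grad2 κ)) ∧
      ContinuousOn (Function.uncurry X) (Ici (0 : ℝ) ×ˢ ISeg) ∧
      (∀ a ∈ ISeg, X 0 a = a) ∧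
      (∀ a ∈ ISeg, ∀ t ∈ Ici (0 : ℝ),
        HasDerivWithinAt (fun s => X s a)
          (∫ α in ISeg, perpGrad κ (X t a - X t α) ∂(μH[(1 : ℝ)]))
          (Ici (0 : ℝ)) t) ∧
      0 < T₀ ∧
      (∀ t : ℝ, T₀ ≤ t → X t '' ISeg = {((0 : ℝ), (0 : ℝ))}) := by
  obtain ⟨Y, hc, h0, h1, hd, hder⟩ := exists_aggregation_flow
  have hpos : (-1 : ℝ) ≤ 1 := by norm_num
  have hproj {a : ℝ × ℝ} (ha : a ∈ ISeg) : ((projIcc (-1 : ℝ) 1 hpos a.1 : ℝ), (0 : ℝ)) = a := by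
    rw [projIcc_of_mem hpos ha.1]
    exact Prod.ext rfl ha.2.symm
  refine ⟨kernelPotential, fun t a => (Y t (projIcc (-1) 1 hpos a.1), 0), 1,
    kernelPotential_hasCompactSupport, kernelPotential_contDiff, grad2_kernelPotential_holder,
    ?_, fun a ha => ?_, fun a ha t ht => ?_, zero_lt_one, fun t ht => ?_⟩
  · have hp : Continuous fun p : ℝ × ℝ × ℝ => (p.1, projIcc (-1 : ℝ) 1 hpos p.2.1) :=
      continuous_fst.prodMk (continuous_projIcc.comp (continuous_fst.comp continuous_snd))
    exact ((hc.comp hp).prodMk continuous_const).continuousOn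
  · simp only [h0, hproj ha]
  · have hint : ∫ α in ISeg, perpGrad kernelPotential
        ((Y t (projIcc (-1) 1 hpos a.1), 0) - (Y t (projIcc (-1) 1 hpos α.1), 0)) ∂μH[(1 : ℝ)] =
        (∫ α, -2 * signedSqrt 0 (Y t (projIcc (-1) 1 hpos a.1) - Y t α), 0) := by
      rw [setIntegral_ISeg]
      simp only [projIcc_val, Prod.mk_sub_mk, sub_self, perpGrad_kernelPotential (hd t ht _ _)]
      have hi := integrable_interaction (volume : Measure (Icc (-1 : ℝ) 1))
        ((signedSqrt_continuous 0).const_mul (-2)) (M := 4) (fun s => by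
          rw [abs_mul]
          have := abs_signedSqrt_le zero_le_one s
          norm_num
          linarith) (x := Y t)
        (hc.comp (continuous_const.prodMk continuous_id))
        (Y t (projIcc (-1) 1 hpos a.1))
      rw [integral_pair hi (integrable_const 0), integral_zero]
    simp only [hint]
    exact (hder t ht _).prodMk (hasDerivWithinAt_const t _ 0)
  · have : ISeg.Nonempty := ⟨(0, 0), by simp [ISeg]⟩
    simp only [h1 t ht]
    exact this.image_const _

end
end

section
/- Let Ξ = {0}×[−1,1]×[−1,1] ⊂ ℝ³ and let H²_Ξ denote the 2-dimensional Hausdorff measure restricted to Ξ. There exist a continuous matrix-valued kernel K : ℝ³ → ℝ^{3×3}, a map X : [0,∞)×Ξ → ℝ³ continuous, differentiable in t, and differentiable in the second coordinate α₂ of α ∈ Ξ with ∂_{α₂}X bounded and Borel measurable, and a time T₀ > 0, such that: X(0,a) = a for all a ∈ Ξ; for every a ∈ Ξ and t ≥ 0 one has ∂ₜX(t,a) = ∫_Ξ K(X(t,a) − X(t,α)) (∂_{α₂}X(t,α)) dH²_Ξ(α), where K(·) acts on the vector ∂_{α₂}X(t,α) ∈ ℝ³ by matrix-vector multiplication; and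 X(t, Ξ) ⊆ {0}×[−1,1]×{0} for all t ≥ T₀. -/
open MeasureTheory Set

noncomputable section

/-- The square `Ξ = {0} × [-1,1] × [-1,1]` in `ℝ³`. -/
def Xi : Set (Fin 3 → ℝ) :=
  {x | x 0 = 0 ∧ x 1 ∈ Icc (-1 : ℝ) 1 ∧ x 2 ∈ Icc (-1 : ℝ) 1}

/-- The collapsed ribbon `{0} × [-1,1] × {0}` in `ℝ³`. -/
def Ribbon0 : Set (Fin 3 → ℝ) :=
  {x | x 0 = 0 ∧ x 1 ∈ Icc (-1 : ℝ) 1 ∧ x 2 = 0}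

/-- A continuous extension to the plane of `(r ^ 2 * x, r ^ 3 * x) ↦ r * x`, for `0 ≤ r`
and `|x| ≤ 2`. -/
def rate (p q : ℝ) : ℝ :=
  p * |p| / max |q| (|p| * √(|p| / 2))

theorem abs_rate_le (p q : ℝ) : |rate p q| ≤ √(2 * |p|) := by
  rcases eq_or_ne p 0 with rfl | hp
  · simp [rate]
  have hp' : 0 < |p| := abs_pos.2 hp
  have hpos : 0 < max |q| (|p| * √(|p| / 2)) := lt_max_of_lt_right (by positivity)
  rw [rate, abs_div, abs_of_pos hpos, div_le_iff₀ hpos, abs_mul, abs_abs]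
  have hsqrt : √(2 * |p|) * √(|p| / 2) = |p| := by
    rw [← Real.sqrt_mul (by positivity), show 2 * |p| * (|p| / 2) = |p| * |p| by ring,
      Real.sqrt_mul_self hp'.le]
  calc |p| * |p| = √(2 * |p|) * (|p| * √(|p| / 2)) := by
        rw [mul_left_comm, hsqrt]
    _ ≤ √(2 * |p|) * max |q| (|p| * √(|p| / 2)) := by
        gcongr
        exact le_max_right _ _

theorem continuous_rate : Continuous fun x : ℝ × ℝ => rate x.1 x.2 := by
  rw [continuous_iff_continuousAt]
  rintro ⟨p, q⟩
  rcases eq_or_ne p 0 with rfl | hp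
  · have hbound : Filter.Tendsto (fun x : ℝ × ℝ => √(2 * |x.1|)) (nhds (0, q)) (nhds 0) := by
      have hcont : Continuous fun x : ℝ × ℝ => √(2 * |x.1|) := by fun_prop
      simpa using hcont.tendsto (0, q)
    have hzero : rate 0 q = 0 := by simp [rate]
    rw [ContinuousAt, hzero]
    exact squeeze_zero_norm (fun x => abs_rate_le x.1 x.2) hbound
  · have hp' : 0 < |p| := abs_pos.2 hp
    have hpos : 0 < max |q| (|p| * √(|p| / 2)) := lt_max_of_lt_right (by positivity)
    unfold rate
    exact ContinuousAt.div (by fun_prop) (by fun_prop) hpos.ne'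

theorem rate_pow_mul {r x : ℝ} (hr : 0 ≤ r) (hx : |x| ≤ 2) :
    rate (r ^ 2 * x) (r ^ 3 * x) = r * x := by
  rcases hr.eq_or_lt with rfl | hr
  · simp [rate]
  rcases eq_or_ne x 0 with rfl | hx0
  · simp [rate]
  have hx' : 0 < |x| := abs_pos.2 hx0
  have hp : |r ^ 2 * x| = r ^ 2 * |x| := by rw [abs_mul, abs_of_pos (by positivity)]
  have hq : |r ^ 3 * x| = r ^ 3 * |x| := by rw [abs_mul, abs_of_pos (by positivity)]
  have hsqrt : √(r ^ 2 * |x| / 2) ≤ r := by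
    rw [Real.sqrt_le_left hr.le]
    nlinarith [pow_pos hr 2]
  have hle : r ^ 2 * |x| * √(r ^ 2 * |x| / 2) ≤ r ^ 3 * |x| :=
    calc r ^ 2 * |x| * √(r ^ 2 * |x| / 2) ≤ r ^ 2 * |x| * r := by gcongr
      _ = r ^ 3 * |x| := by ring
  rw [rate, hp, hq, max_eq_left hle]
  field_simp

/-- The time profile `(1 - t)₊`. -/
def profile (t : ℝ) : ℝ :=
  max (1 - t) 0

theorem profile_nonneg (t : ℝ) : 0 ≤ profile t :=
  le_max_right _ _

theorem continuous_profile : Continuous profile := by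
  unfold profile
  fun_prop

theorem profile_eq_zero {t : ℝ} (ht : 1 ≤ t) : profile t = 0 :=
  max_eq_right (by linarith)

theorem profile_zero : profile 0 = 1 := by
  simp [profile]

theorem hasDerivAt_profile_pow (n : ℕ) (t : ℝ) :
    HasDerivAt (fun s => profile s ^ (n + 2)) (-((n + 2) * profile t ^ (n + 1))) t := by
  have hleft : ∀ s ≤ (1 : ℝ), profile s = 1 - s := fun s hs => max_eq_left (by linarith)
  have hpoly : HasDerivAt (fun s : ℝ => (1 - s) ^ (n + 2)) (-((n + 2) * (1 - t) ^ (n + 1))) t := by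
    refine (((hasDerivAt_id' t).const_sub 1).fun_pow (n + 2)).congr_deriv ?_
    push_cast
    simp
  have hconst : HasDerivAt (fun _ : ℝ => (0 : ℝ)) 0 t := hasDerivAt_const t 0
  rcases lt_trichotomy t 1 with ht | rfl | ht
  · rw [hleft t ht.le]
    refine hpoly.congr_of_eventuallyEq ?_
    filter_upwards [Iio_mem_nhds ht] with s hs
    rw [hleft s (le_of_lt hs)]
  · rw [← hasDerivWithinAt_univ, ← Iic_union_Ici (a := (1 : ℝ))]
    refine HasDerivWithinAt.union ?_ ?_
    · rw [hleft 1 le_rfl]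
      exact hpoly.hasDerivWithinAt.congr (fun s hs => by rw [hleft s hs]) (by rw [hleft 1 le_rfl])
    · rw [profile_eq_zero le_rfl]
      refine HasDerivWithinAt.congr (f := fun _ => 0) ?_
        (fun s hs => by simp [profile_eq_zero (mem_Ici.1 hs)]) (by simp [profile_eq_zero le_rfl])
      simpa using hconst.hasDerivWithinAt
  · rw [profile_eq_zero ht.le]
    refine HasDerivAt.congr_of_eventuallyEq (f := fun _ => 0) (by simpa using hconst) ?_
    filter_upwards [Ioi_mem_nhds ht] with s hs
    simp [profile_eq_zero (le_of_lt hs)]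

/-- The inclusion of the plane in `ℝ³` as `{x | x 0 = 0}`. -/
def planeEmb (y : Fin 2 → ℝ) : Fin 3 → ℝ :=
  ![0, y 0, y 1]

theorem isometry_planeEmb : Isometry planeEmb := by
  refine Isometry.of_dist_eq fun x y => le_antisymm ?_ ?_
  · refine (dist_pi_le_iff dist_nonneg).2 fun i => ?_
    fin_cases i
    · simp [planeEmb]
    · exact dist_le_pi_dist x y 0
    · exact dist_le_pi_dist x y 1
  · refine (dist_pi_le_iff dist_nonneg).2 fun i => ?_
    fin_cases i
    · exact dist_le_pi_dist (planeEmb x) (planeEmb y) 1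
    · exact dist_le_pi_dist (planeEmb x) (planeEmb y) 2

theorem preimage_planeEmb_Xi : planeEmb ⁻¹' Xi = Icc (-1) 1 := by
  ext y
  simp [planeEmb, Xi, Pi.le_def, Fin.forall_fin_two]
  tauto

theorem isClosed_Xi : IsClosed Xi := by
  refine (isClosed_eq (continuous_apply 0) continuous_const).inter
    ((isClosed_Icc.preimage (continuous_apply 1)).inter (isClosed_Icc.preimage (continuous_apply 2)))

theorem map_planeEmb_volume_Icc :
    (volume.restrict (Icc (-1) 1)).map planeEmb = (μH[(2 : ℝ)]).restrict Xi := by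
  have hrange : Xi ⊆ range planeEmb := by
    rintro x ⟨h0, -⟩
    refine ⟨![x 1, x 2], ?_⟩
    ext i
    fin_cases i <;> simp [planeEmb, h0]
  have hvol : (volume : Measure (Fin 2 → ℝ)) = μH[(2 : ℝ)] := by
    rw [← hausdorffMeasure_pi_real]
    simp
  rw [← preimage_planeEmb_Xi,
    ← Measure.restrict_map isometry_planeEmb.continuous.measurable isClosed_Xi.measurableSet, hvol,
    isometry_planeEmb.map_hausdorffMeasure (Or.inl zero_le_two),
    Measure.restrict_restrict isClosed_Xi.measurableSet, inter_eq_left.2 hrange]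

theorem setIntegral_Xi (f : (Fin 3 → ℝ) → ℝ) :
    ∫ α in Xi, f α ∂(μH[(2 : ℝ)]) = ∫ y in Icc (-1) 1, f (planeEmb y) := by
  rw [← map_planeEmb_volume_Icc,
    isometry_planeEmb.isClosedEmbedding.measurableEmbedding.integral_map]

theorem setIntegral_Icc_neg_one_one_apply {ι : Type*} [Fintype ι] (i : ι) :
    ∫ y in Icc (-1 : ι → ℝ) 1, y i = 0 := by
  have hodd : ∫ y in Icc (-1 : ι → ℝ) 1, y i = -∫ y in Icc (-1 : ι → ℝ) 1, y i := by
    rw [← integral_neg, ← integral_indicator measurableSet_Icc,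
      ← integral_indicator measurableSet_Icc, ← integral_neg_eq_self]
    congr 1
    ext y
    have hmem : -y ∈ Icc (-1 : ι → ℝ) 1 ↔ y ∈ Icc (-1 : ι → ℝ) 1 := by
      rw [mem_Icc, mem_Icc, neg_le_neg_iff, neg_le, and_comm]
    by_cases hy : y ∈ Icc (-1 : ι → ℝ) 1
    · rw [indicator_of_mem hy, indicator_of_mem (hmem.2 hy), Pi.neg_apply]
    · rw [indicator_of_notMem hy, indicator_of_notMem (mt hmem.1 hy)]
  linarith

theorem setIntegral_Xi_sub (z : ℝ) : ∫ α in Xi, (z - α 2) ∂(μH[(2 : ℝ)]) = 4 * z := by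
  have hint : IntegrableOn (fun y : Fin 2 → ℝ => y 1) (Icc (-1) 1) :=
    (continuous_apply 1).continuousOn.integrableOn_compact isCompact_Icc
  have hconst : IntegrableOn (fun _ : Fin 2 → ℝ => z) (Icc (-1) 1) :=
    continuousOn_const.integrableOn_compact isCompact_Icc
  have hvol : volume.real (Icc (-1 : Fin 2 → ℝ) 1) = 4 := by
    rw [Measure.real, Real.volume_Icc_pi, ENNReal.toReal_prod]
    norm_num [Fin.prod_univ_two]
  rw [setIntegral_Xi]
  change ∫ y in Icc (-1 : Fin 2 → ℝ) 1, (z - y 1) = 4 * z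
  rw [integral_sub hconst hint, setIntegral_Icc_neg_one_one_apply, setIntegral_const, hvol,
    smul_eq_mul, sub_zero]

/-- The action of `collapseKernel` on the vector `(0, 1, 0)`. -/
def collapseField (x : Fin 3 → ℝ) : Fin 3 → ℝ :=
  ![(2 * rate (x 2) (x 0 + x 2) - 3 * x 2) / 4, 0, -(2 * rate (x 2) (x 0 + x 2)) / 4]

/-- The matrix whose second column is `collapseField x` and whose other columns vanish. -/
def collapseKernel (x : Fin 3 → ℝ) : Matrix (Fin 3) (Fin 3) ℝ :=
  Matrix.vecMulVec (collapseField x) ![0, 1, 0]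

/-- A flow of the square `Xi` which reaches the ribbon `Ribbon0` at time `1`. The time is
encoded in the ratio of the differences of the first and third coordinates. -/
def collapseFlow (t : ℝ) (a : Fin 3 → ℝ) : Fin 3 → ℝ :=
  ![(profile t ^ 3 - profile t ^ 2) * a 2, a 1, profile t ^ 2 * a 2]

theorem continuous_collapseKernel : Continuous collapseKernel := by
  have hrate : Continuous fun x : Fin 3 → ℝ => rate (x 2) (x 0 + x 2) :=
    continuous_rate.comp (by fun_prop : Continuous fun x : Fin 3 → ℝ => (x 2, x 0 + x 2))
  have hfield : Continuous collapseField := by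
    refine continuous_pi fun i => ?_
    fin_cases i <;> simp only [collapseField] <;> simp <;> fun_prop
  exact hfield.matrix_vecMulVec continuous_const

theorem collapseKernel_mulVec (x : Fin 3 → ℝ) :
    (collapseKernel x).mulVec ![0, 1, 0] = collapseField x := by
  ext i
  simp [collapseKernel, Matrix.mulVec, dotProduct, Fin.sum_univ_three, Matrix.vecMulVec_apply]

theorem continuous_uncurry_collapseFlow : Continuous (Function.uncurry collapseFlow) := by
  have hprofile : Continuous fun x : ℝ × (Fin 3 → ℝ) => profile x.1 :=
    continuous_profile.comp continuous_fst
  refine continuous_pi fun i => ?_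
  fin_cases i <;> simp only [Function.uncurry, collapseFlow] <;> simp <;> fun_prop

/-- The velocity of `collapseFlow` at time `t` along the line through a point with third
coordinate `1`. -/
def collapseVelocity (t : ℝ) : Fin 3 → ℝ :=
  ![2 * profile t - 3 * profile t ^ 2, 0, -(2 * profile t)]

theorem hasDerivAt_collapseFlow (t : ℝ) (a : Fin 3 → ℝ) :
    HasDerivAt (fun s => collapseFlow s a) (a 2 • collapseVelocity t) t := by
  have h2 := hasDerivAt_profile_pow 0 t
  have h3 := hasDerivAt_profile_pow 1 t
  norm_num at h2 h3
  refine hasDerivAt_pi.2 fun i => ?_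
  fin_cases i
  · refine ((h3.sub h2).mul_const (a 2)).congr_deriv ?_
    simp [collapseVelocity]
    ring
  · simpa [collapseVelocity, collapseFlow] using hasDerivAt_const t (a 1)
  · refine (h2.mul_const (a 2)).congr_deriv ?_
    simp [collapseVelocity]
    ring

theorem collapseField_sub (t : ℝ) {a α : Fin 3 → ℝ} (ha : a ∈ Xi) (hα : α ∈ Xi) :
    collapseField (collapseFlow t a - collapseFlow t α) =
      ((a 2 - α 2) / 4) • collapseVelocity t := by
  obtain ⟨-, -, ha1, ha2⟩ := ha
  obtain ⟨-, -, hα1, hα2⟩ := hα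
  have hx : |a 2 - α 2| ≤ 2 := abs_le.2 ⟨by linarith, by linarith⟩
  have h2 : (collapseFlow t a - collapseFlow t α) 2 = profile t ^ 2 * (a 2 - α 2) := by
    simp [collapseFlow]
    ring
  have h0 : (collapseFlow t a - collapseFlow t α) 0 + profile t ^ 2 * (a 2 - α 2) =
      profile t ^ 3 * (a 2 - α 2) := by
    simp [collapseFlow]
    ring
  rw [collapseField, h2, h0, rate_pow_mul (profile_nonneg t) hx]
  ext i
  fin_cases i <;> simp [collapseVelocity] <;> ring

theorem integral_collapseKernel (t : ℝ) {a : Fin 3 → ℝ} (ha : a ∈ Xi) :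
    ∫ α in Xi, (collapseKernel (collapseFlow t a - collapseFlow t α)).mulVec ![0, 1, 0]
      ∂(μH[(2 : ℝ)]) = a 2 • collapseVelocity t := by
  rw [setIntegral_congr_fun isClosed_Xi.measurableSet
    (g := fun α => ((a 2 - α 2) / 4) • collapseVelocity t)
    fun α hα => by simp only [collapseKernel_mulVec, collapseField_sub t ha hα],
    integral_smul_const, integral_div, setIntegral_Xi_sub, mul_div_cancel_left₀ _ four_ne_zero]

theorem hasDerivAt_collapseFlow_update (t : ℝ) (a : Fin 3 → ℝ) (s : ℝ) :
    HasDerivAt (fun s => collapseFlow t (Function.update a 1 s)) ![0, 1, 0] s := by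
  refine hasDerivAt_pi.2 fun i => ?_
  fin_cases i
  · simpa [collapseFlow] using hasDerivAt_const s _
  · simpa [collapseFlow] using hasDerivAt_id' s
  · simpa [collapseFlow] using hasDerivAt_const s _

theorem collapseFlow_zero {a : Fin 3 → ℝ} (ha : a ∈ Xi) : collapseFlow 0 a = a := by
  ext i
  fin_cases i <;> simp [collapseFlow, profile_zero, ha.1]

theorem image_collapseFlow_subset {t : ℝ} (ht : 1 ≤ t) : collapseFlow t '' Xi ⊆ Ribbon0 := by
  rintro _ ⟨a, ⟨-, ha, -⟩, rfl⟩
  exact ⟨by simp [collapseFlow, profile_eq_zero ht], ha,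
    by simp [collapseFlow, profile_eq_zero ht]⟩

/-- There are a continuous matrix kernel `K : ℝ³ → ℝ^{3×3}`, a map
`X : [0,∞) × Ξ → ℝ³` (continuous, differentiable in `t` and in `α₂`, with bounded
measurable `∂_{α₂} X`) and `T₀ > 0` such that `X 0 = id` on `Ξ`,
`∂ₜ X (t,a) = ∫_Ξ K (X(t,a) - X(t,α)) ∂_{α₂}X(t,α) dH²_Ξ(α)` and
`X t '' Ξ ⊆ {0} × [-1,1] × {0}` for all `t ≥ T₀`. -/
theorem statement19 :
    ∃ (K : (Fin 3 → ℝ) → Matrix (Fin 3) (Fin 3) ℝ)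
      (X : ℝ → (Fin 3 → ℝ) → (Fin 3 → ℝ))
      (D : ℝ → (Fin 3 → ℝ) → (Fin 3 → ℝ))
      (T₀ : ℝ),
      Continuous K ∧
      ContinuousOn (Function.uncurry X) (Ici (0 : ℝ) ×ˢ Xi) ∧
      (∃ C : ℝ, ∀ t ∈ Ici (0 : ℝ), ∀ a ∈ Xi, ‖D t a‖ ≤ C) ∧
      (∀ t ∈ Ici (0 : ℝ), Measurable (D t)) ∧
      (∀ t ∈ Ici (0 : ℝ), ∀ a ∈ Xi,
        HasDerivWithinAt (fun s => X t (Function.update a 1 s)) (D t a)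
          (Icc (-1 : ℝ) 1) (a 1)) ∧
      (∀ a ∈ Xi, X 0 a = a) ∧
      (∀ a ∈ Xi, ∀ t ∈ Ici (0 : ℝ),
        HasDerivWithinAt (fun s => X s a)
          (∫ α in Xi, (K (X t a - X t α)).mulVec (D t α) ∂(μH[(2 : ℝ)]))
          (Ici (0 : ℝ)) t) ∧
      0 < T₀ ∧
      (∀ t : ℝ, T₀ ≤ t → X t '' Xi ⊆ Ribbon0) := by
  refine ⟨collapseKernel, collapseFlow, fun _ _ => ![0, 1, 0], 1, continuous_collapseKernel,
    continuous_uncurry_collapseFlow.continuousOn, ⟨_, fun _ _ _ _ => le_rfl⟩,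
    fun _ _ => measurable_const,
    fun t _ a _ => (hasDerivAt_collapseFlow_update t a (a 1)).hasDerivWithinAt,
    fun a ha => collapseFlow_zero ha, fun a ha t _ => ?_, one_pos,
    fun t ht => image_collapseFlow_subset ht⟩
  rw [integral_collapseKernel t ha]
  exact (hasDerivAt_collapseFlow t a).hasDerivWithinAt

end
end
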